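/- arXiv:2006.14908 — 4 statements merged into one kernel-verified Lean document; each statement's English description precedes it below -/
import Mathlib

section
/- Let n ≥ 2 and k ≥ 1 be integers with n ≤ 2k. Then there exist a set A ⊆ ℂ of n distinct points, a point x ∈ ℂ \ A, and a natural number N with N ≥ 2^{√(n·k)/3} (as reals), together with N pairwise non-homotopic x-loops in the complement of A such that none of them passes through x, each has fewer than k self-intersections, and every pair of them cross fewer than k times. -/
open unitInterval

/-- `γ` does not pass through `x` : its interior avoids the basepoint. -/
def AvoidsBase {A : Set ℂ} {x : ℂ} {hx : x ∉ A}
    (γ : Path (X := {z : ℂ // z ∉ A}) ⟨x, hx⟩ ⟨x, hx⟩) : Prop :=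
  ∀ t : I, t ≠ 0 → t ≠ 1 → (γ t : ℂ) ≠ x

/-- `γ` has fewer than `k` self-intersections: the set
`{(s,t) : 0 < s < t < 1, γ s = γ t}` has fewer than `k` elements. -/
def SelfIntersLt {A : Set ℂ} {x : ℂ} {hx : x ∉ A}
    (γ : Path (X := {z : ℂ // z ∉ A}) ⟨x, hx⟩ ⟨x, hx⟩) (k : ℕ) : Prop :=
  {p : I × I | p.1 ≠ 0 ∧ p.2 ≠ 1 ∧ p.1 < p.2 ∧ γ p.1 = γ p.2}.encard < (k : ℕ∞)

/-- `γ` and `γ'` cross fewer than `k` times: the set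
`{(s,t) ∈ (0,1)² : γ s = γ' t}` has fewer than `k` elements. -/
def CrossingsLt {A : Set ℂ} {x : ℂ} {hx : x ∉ A}
    (γ γ' : Path (X := {z : ℂ // z ∉ A}) ⟨x, hx⟩ ⟨x, hx⟩) (k : ℕ) : Prop :=
  {p : I × I | p.1 ≠ 0 ∧ p.1 ≠ 1 ∧ p.2 ≠ 0 ∧ p.2 ≠ 1 ∧ γ p.1 = γ' p.2}.encard < (k : ℕ∞)

/-- Homotopies rel endpoints in `ℂ \ {0}` lift through `Complex.exp`. -/
theorem exists_lift_exp_of_homotopy (K : C(I × I, ℂ)) (hK : ∀ p, K p ≠ 0) (F₀ F₁ : C(I, ℂ))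
    (h₀ : ∀ t, Complex.exp (F₀ t) = K (0, t)) (h₁ : ∀ t, Complex.exp (F₁ t) = K (1, t))
    (hs : F₀ 0 = F₁ 0)
    (hleft : ∀ s, K (s, 0) = K (0, 0)) (hright : ∀ s, K (s, 1) = K (0, 1)) :
    ∃ L : C(I × I, ℂ), (∀ p, Complex.exp (L p) = K p) ∧ (∀ t, L (0, t) = F₀ t) ∧
      (∀ t, L (1, t) = F₁ t) ∧ (∀ s, L (s, 0) = F₀ 0) ∧ ∀ s, L (s, 1) = F₀ 1 := by
  have cov := Complex.isCoveringMap_exp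
  let K' : C(I × I, {z : ℂ // z ≠ 0}) := ⟨fun p ↦ ⟨K p, hK p⟩, by fun_prop⟩
  have H₀ : ∀ t, K' (0, t) = ⟨Complex.exp (F₀ t), Complex.exp_ne_zero _⟩ :=
    fun t ↦ Subtype.ext (h₀ t).symm
  let L := cov.liftHomotopy K' F₀ H₀
  have hL : ∀ p, Complex.exp (L p) = K p := fun p ↦
    congrArg Subtype.val (congrFun (cov.liftHomotopy_lifts K' F₀ H₀) p)
  have hL₀ : ∀ t, L (0, t) = F₀ t := cov.liftHomotopy_zero K' F₀ H₀
  have side : ∀ a, (∀ s, K (s, a) = K (0, a)) → ∀ s, L (s, a) = F₀ a := by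
    intro a ha s
    rw [← hL₀ a]
    exact cov.const_of_comp (g := fun s : I ↦ L (s, a)) (by fun_prop)
      (fun s s' ↦ Subtype.ext (by simp only [hL, ha s, ha s'])) s 0
  refine ⟨L, hL, hL₀, ?_, side 0 hleft, side 1 hright⟩
  have key : (fun t : I ↦ L (1, t)) = F₁ :=
    cov.eq_of_comp_eq (by fun_prop) F₁.continuous
      (funext fun t ↦ Subtype.ext (by simp [hL, h₁])) 0 (by rw [side 0 hleft, hs])
  exact fun t ↦ congrFun key t

/-- A path in `ℂ \ {0}` from the negative to the positive imaginary axis that avoids the negative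
real axis is not homotopic to one that avoids the positive real axis. -/
theorem not_exists_homotopy_across_zero (K : C(I × I, ℂ)) (hK : ∀ p, K p ≠ 0) {a b : ℝ}
    (ha : 0 < a) (hb : 0 < b) (h₀ : ∀ t, K (0, t) ∈ Complex.slitPlane)
    (h₁ : ∀ t, -K (1, t) ∈ Complex.slitPlane)
    (hleft : ∀ s, K (s, 0) = a * -Complex.I) (hright : ∀ s, K (s, 1) = b * Complex.I) : False := by
  let G₀ : C(I, ℂ) := ⟨fun t ↦ Complex.log (K (0, t)), Continuous.clog (by fun_prop) h₀⟩
  let G₁ : C(I, ℂ) := ⟨fun t ↦ Complex.log (-K (1, t)) - Real.pi * Complex.I,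
    (Continuous.clog (by fun_prop) h₁).sub continuous_const⟩
  obtain ⟨L, -, -, hL₁, -, hL⟩ := exists_lift_exp_of_homotopy K hK G₀ G₁
    (fun t ↦ Complex.exp_log (hK _))
    (fun t ↦ by
      change Complex.exp (Complex.log (-K (1, t)) - Real.pi * Complex.I) = _
      rw [Complex.exp_sub, Complex.exp_log (neg_ne_zero.2 (hK _)), Complex.exp_pi_mul_I]; ring)
    (by
      change Complex.log (K (0, 0)) = Complex.log (-K (1, 0)) - Real.pi * Complex.I
      rw [hleft, hleft, mul_neg, neg_neg, ← mul_neg,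
        Complex.log_ofReal_mul ha (neg_ne_zero.2 Complex.I_ne_zero),
        Complex.log_ofReal_mul ha Complex.I_ne_zero, Complex.log_I, Complex.log_neg_I]
      ring)
    (fun s ↦ by rw [hleft, hleft]) (fun s ↦ by rw [hright, hright])
  have h := hL 1
  rw [hL₁] at h
  change Complex.log (-K (1, 1)) - Real.pi * Complex.I = Complex.log (K (0, 1)) at h
  rw [hright, hright, ← mul_neg, Complex.log_ofReal_mul hb (neg_ne_zero.2 Complex.I_ne_zero),
    Complex.log_ofReal_mul hb Complex.I_ne_zero, Complex.log_I, Complex.log_neg_I] at h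
  have := congrArg Complex.im h
  simp at this
  linarith [Real.pi_pos]

/-- The piecewise linear function on `[0, M]` with value `v l` at each integer `l ≤ M`. -/
def linearInterp (v : ℕ → ℝ) (M : ℕ) (u : ℝ) : ℝ :=
  ∑ i ∈ Finset.range (M + 1), v i * max 0 (1 - |u - i|)

theorem continuous_linearInterp (v : ℕ → ℝ) (M : ℕ) : Continuous (linearInterp v M) := by
  unfold linearInterp
  fun_prop

theorem linearInterp_add {v : ℕ → ℝ} {M l : ℕ} (hl : l < M) {τ : ℝ} (h0 : 0 ≤ τ) (h1 : τ ≤ 1) :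
    linearInterp v M (l + τ) = (1 - τ) * v l + τ * v (l + 1) := by
  unfold linearInterp
  rw [Finset.sum_eq_add (a := l) (b := l + 1) (by omega)]
  · have e1 : (l : ℝ) + τ - l = τ := by ring
    have e2 : (l : ℝ) + τ - (l + 1 : ℕ) = -(1 - τ) := by push_cast; ring
    rw [e1, e2, abs_neg, abs_of_nonneg h0, abs_of_nonneg (by linarith), max_eq_right (by linarith),
      max_eq_right (by linarith)]
    ring
  · intro i _ hi
    have : 1 ≤ |(l : ℝ) + τ - i| := by
      rcases lt_or_gt_of_ne hi.1 with h | h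
      · have : (i : ℝ) + 1 ≤ l := by exact_mod_cast h
        exact le_abs.2 (.inl (by linarith))
      · have : (l : ℝ) + 2 ≤ i := by exact_mod_cast (show l + 2 ≤ i by omega)
        exact le_abs.2 (.inr (by linarith))
    rw [max_eq_left (by linarith), mul_zero]
  · intro h; simp at h; omega
  · intro h; simp at h; omega

theorem linearInterp_natCast {v : ℕ → ℝ} {M l : ℕ} (hl : l ≤ M) (hM : 0 < M) :
    linearInterp v M l = v l := by
  rcases hl.lt_or_eq with h | rfl
  · simpa using linearInterp_add (v := v) h le_rfl zero_le_one
  · have := linearInterp_add (v := v) (M := l) (l := l - 1) (by omega) zero_le_one le_rfl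
    simpa [Nat.sub_add_cancel hM, Nat.cast_sub (show 1 ≤ l from hM)] using this

theorem exists_eq_natCast_add {M : ℕ} {u : ℝ} (h0 : 0 ≤ u) (h1 : u < M) :
    ∃ (l : ℕ) (τ : ℝ), l < M ∧ 0 ≤ τ ∧ τ < 1 ∧ u = l + τ :=
  ⟨⌊u⌋₊, u - ⌊u⌋₊, (Nat.floor_lt h0).2 h1, sub_nonneg.2 (Nat.floor_le h0),
    by linarith [Nat.lt_floor_add_one u], by ring⟩

theorem linearInterp_le_half {v : ℕ → ℝ} {M : ℕ} (hv : ∀ l, |v l| ≤ 1 / 2) {u : ℝ}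
    (h0 : 0 ≤ u) (h1 : u ≤ M) (hM : 0 < M) : linearInterp v M u ≤ 1 / 2 := by
  rcases h1.lt_or_eq with h1 | rfl
  · obtain ⟨l, τ, hl, hτ0, hτ1, rfl⟩ := exists_eq_natCast_add h0 h1
    rw [linearInterp_add hl hτ0 hτ1.le]
    have a := (abs_le.1 (hv l)).2
    have b := (abs_le.1 (hv (l + 1))).2
    nlinarith
  · rw [linearInterp_natCast le_rfl hM]
    exact (abs_le.1 (hv M)).2

/-- The covering `ℝ × ℝ → ℂ \ {0}` unrolling the plane around `0`, with angle `2π u / m` and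
radius `exp y`. -/
noncomputable def unrolled (m : ℕ) (u y : ℝ) : ℂ :=
  Complex.exp (y + (2 * Real.pi * (u / m) : ℝ) * Complex.I)

theorem unrolled_eq_iff {m : ℕ} (hm : 0 < m) {u y u' y' : ℝ} :
    unrolled m u y = unrolled m u' y' ↔ y = y' ∧ ∃ j : ℤ, u = u' + m * j := by
  have hm' : (m : ℝ) ≠ 0 := by positivity
  unfold unrolled
  rw [Complex.exp_eq_exp_iff_exists_int]
  have key : ∀ j : ℤ, ((y : ℂ) + (2 * Real.pi * (u / m) : ℝ) * Complex.I =
      y' + (2 * Real.pi * (u' / m) : ℝ) * Complex.I + j * (2 * Real.pi * Complex.I)) ↔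
      (y = y' ∧ u = u' + m * j) := by
    intro j
    rw [Complex.ext_iff]
    simp only [Complex.add_re, Complex.add_im, Complex.mul_re, Complex.mul_im, Complex.ofReal_re,
      Complex.ofReal_im, Complex.I_re, Complex.I_im, Complex.intCast_re, Complex.intCast_im,
      Complex.re_ofNat, Complex.im_ofNat]
    refine and_congr (by ring_nf) ?_
    have : 2 * Real.pi ≠ 0 := by positivity
    constructor
    · intro h
      have h2 : 2 * Real.pi * (u / m) = 2 * Real.pi * (u' / m + j) := by linarith
      have h3 := mul_left_cancel₀ this h2
      field_simp at h3
      linarith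
    · rintro rfl
      field_simp
      ring
  simp only [key, exists_and_left]

theorem norm_unrolled (m : ℕ) (u y : ℝ) : ‖unrolled m u y‖ = Real.exp y := by
  unfold unrolled
  rw [Complex.norm_exp]
  simp

theorem unrolled_ne_zero (m : ℕ) (u y : ℝ) : unrolled m u y ≠ 0 := Complex.exp_ne_zero _

/-- The `r`-fold spiral around `0` whose logarithmic radius interpolates the heights `v`. -/
noncomputable def spiral (m r : ℕ) (v : ℕ → ℝ) (t : ℝ) : ℂ :=
  unrolled m ((m * r : ℕ) * t) (linearInterp v (m * r) ((m * r : ℕ) * t))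

theorem continuous_spiral (m r : ℕ) (v : ℕ → ℝ) : Continuous (spiral m r v) := by
  have := continuous_linearInterp v (m * r)
  unfold spiral unrolled
  fun_prop

theorem exists_cell {M : ℕ} (hM : 0 < M) {t : I} (h0 : t ≠ 0) (h1 : t ≠ 1) :
    ∃ (l : ℕ) (τ : ℝ), l < M ∧ 0 ≤ τ ∧ τ < 1 ∧ M * (t : ℝ) = l + τ ∧ (τ = 0 → l ≠ 0) := by
  have t0 : (0 : ℝ) < t := lt_of_le_of_ne t.2.1 (fun h ↦ h0 (Subtype.ext h.symm))
  have t1 : (t : ℝ) < 1 := lt_of_le_of_ne t.2.2 (fun h ↦ h1 (Subtype.ext h))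
  have hM' : (0 : ℝ) < M := by exact_mod_cast hM
  obtain ⟨l, τ, a, b, c, d⟩ := exists_eq_natCast_add (M := M) (u := M * t) (by positivity)
    (by nlinarith)
  refine ⟨l, τ, a, b, c, d, ?_⟩
  rintro rfl rfl
  have : 0 < (M : ℝ) * t := by positivity
  simp at d
  rcases d with d | d
  · omega
  · exact h0 d

theorem exists_cells_of_spiral_eq {m r r' : ℕ} (hm : 0 < m) (hr : 0 < r) (hr' : 0 < r')
    {v v' : ℕ → ℝ} {s t : I} (hs0 : s ≠ 0) (hs1 : s ≠ 1) (ht0 : t ≠ 0) (ht1 : t ≠ 1)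
    (h : spiral m r v s = spiral m r' v' t) :
    ∃ (l l' : ℕ) (τ : ℝ), l < m * r ∧ l' < m * r' ∧ 0 ≤ τ ∧ τ < 1 ∧
      (m * r : ℕ) * (s : ℝ) = l + τ ∧ (m * r' : ℕ) * (t : ℝ) = l' + τ ∧ l % m = l' % m ∧
      (1 - τ) * v l + τ * v (l + 1) = (1 - τ) * v' l' + τ * v' (l' + 1) ∧
      (τ = 0 → l ≠ 0) := by
  obtain ⟨l, τ, hl, h0, h1, e, hz⟩ := exists_cell (Nat.mul_pos hm hr) hs0 hs1
  obtain ⟨l', τ', hl', h0', h1', e', -⟩ := exists_cell (Nat.mul_pos hm hr') ht0 ht1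
  unfold spiral at h
  rw [unrolled_eq_iff hm, e, e', linearInterp_add hl h0 h1.le, linearInterp_add hl' h0' h1'.le] at h
  obtain ⟨hy, j, hj⟩ := h
  have hfr : ((l : ℤ) - l' - m * j : ℤ) = 0 := by
    have a : (((l : ℤ) - l' - m * j : ℤ) : ℝ) < 1 := by push_cast; linarith
    have b : (-1 : ℝ) < (((l : ℤ) - l' - m * j : ℤ) : ℝ) := by push_cast; linarith
    have a' : ((l : ℤ) - l' - m * j : ℤ) < 1 := by exact_mod_cast a
    have b' : -1 < ((l : ℤ) - l' - m * j : ℤ) := by exact_mod_cast b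
    omega
  have hττ : τ = τ' := by
    have : (((l : ℤ) - l' - m * j : ℤ) : ℝ) = 0 := by exact_mod_cast hfr
    push_cast at this
    linarith
  subst hττ
  refine ⟨l, l', τ, hl, hl', h0, h1, e, e', ?_, hy, hz⟩
  have : (l : ℤ) % m = l' % m := by
    rw [show (l : ℤ) = l' + m * j by linarith, Int.add_mul_emod_self_left]
  exact_mod_cast this

/-- Crossings of two spirals are counted by the pairs of cells containing them. -/
theorem encard_le_card_of_cells {m r r' : ℕ} (hm : 0 < m) (hr : 0 < r) (hr' : 0 < r')
    {v v' : ℕ → ℝ} {S : Set (I × I)} {T : Finset ((ℕ × ℕ) × ℕ)}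
    (h : ∀ p ∈ S, ∃ (l l' : ℕ) (τ : ℝ), 0 ≤ τ ∧ τ < 1 ∧
      (m * r : ℕ) * (p.1 : ℝ) = l + τ ∧ (m * r' : ℕ) * (p.2 : ℝ) = l' + τ ∧ l % m = l' % m ∧
      (1 - τ) * v l + τ * v (l + 1) = (1 - τ) * v' l' + τ * v' (l' + 1) ∧
      ¬ (v l = v' l' ∧ v (l + 1) = v' (l' + 1)) ∧ ((l / m, l' / m), l % m) ∈ T) :
    S.encard ≤ T.card := by
  have hM : ((m * r : ℕ) : ℝ) ≠ 0 := by positivity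
  have hM' : ((m * r' : ℕ) : ℝ) ≠ 0 := by positivity
  have floor_eq : ∀ {l : ℕ} {τ : ℝ}, 0 ≤ τ → τ < 1 → ⌊(l : ℝ) + τ⌋₊ = l := by
    intro l τ h0 h1
    rw [Nat.floor_eq_iff (by positivity)]
    exact ⟨by linarith, by linarith⟩
  rw [← Set.encard_coe_eq_coe_finsetCard]
  refine Set.encard_le_encard_of_injOn (f := fun p ↦ ((⌊(m * r : ℕ) * (p.1 : ℝ)⌋₊ / m,
    ⌊(m * r' : ℕ) * (p.2 : ℝ)⌋₊ / m), ⌊(m * r : ℕ) * (p.1 : ℝ)⌋₊ % m)) ?_ ?_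
  · intro p hp
    obtain ⟨l, l', τ, h0, h1, e, e', -, -, -, hT⟩ := h p hp
    simpa only [e, e', floor_eq h0 h1, Finset.mem_coe] using hT
  · intro p hp q hq hpq
    obtain ⟨l, l', τ, h0, h1, e, e', hmod, heq, hne, -⟩ := h p hp
    obtain ⟨k, k', ρ, g0, g1, d, d', gmod, geq, -, -⟩ := h q hq
    simp only [e, e', d, d', floor_eq h0 h1, floor_eq g0 g1, Prod.mk.injEq] at hpq
    obtain ⟨⟨hdiv, hdiv'⟩, hm1⟩ := hpq
    obtain rfl : l = k := by rw [← Nat.div_add_mod l m, ← Nat.div_add_mod k m, hdiv, hm1]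
    obtain rfl : l' = k' := by
      rw [← Nat.div_add_mod l' m, ← Nat.div_add_mod k' m, hdiv', ← hmod, ← gmod]
    by_cases hτ : τ = ρ
    · subst hτ
      exact Prod.ext (Subtype.ext (mul_left_cancel₀ hM (e.trans d.symm)))
        (Subtype.ext (mul_left_cancel₀ hM' (e'.trans d'.symm)))
    · exfalso
      have hd : (τ - ρ) * (v (l + 1) - v' (l' + 1) - (v l - v' l')) = 0 := by linarith
      have hd' := (mul_eq_zero.1 hd).resolve_left (sub_ne_zero.2 hτ)
      have hl : v l - v' l' = 0 := by
        have : τ * (v (l + 1) - v' (l' + 1) - (v l - v' l')) = 0 := by rw [hd', mul_zero]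
        linarith
      exact hne ⟨by linarith, by linarith⟩

/-- Heights of a spiral with `M` cells: zero at the ends, nonzero and small in between. -/
structure IsProfile (M : ℕ) (v : ℕ → ℝ) : Prop where
  zero : v 0 = 0
  last : v M = 0
  ne_zero : ∀ l, 0 < l → l < M → v l ≠ 0
  abs_le : ∀ l, |v l| ≤ 1 / 2

/-- The origin, the nontrivial `m`-th roots of unity, and remote points. -/
noncomputable def puncture (m l : ℕ) : ℂ :=
  if l = 0 then 0 else if l < m then unrolled m l 0 else l + 3

theorem norm_natCast_add_three (l : ℕ) : ‖(l + 3 : ℂ)‖ = l + 3 := by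
  have : (l + 3 : ℂ) = ((l + 3 : ℕ) : ℂ) := by push_cast; rfl
  rw [this, Complex.norm_natCast]
  push_cast; rfl

theorem puncture_injective {m : ℕ} : Function.Injective (puncture m) := by
  intro a b h
  have nrm : ∀ l : ℕ, (l : ℂ) + 3 ≠ 0 := fun l h0 ↦ by
    have := norm_natCast_add_three l
    rw [h0, norm_zero] at this
    have : (0 : ℝ) ≤ l := by positivity
    linarith
  have far : ∀ k l : ℕ, unrolled m k 0 ≠ (l : ℂ) + 3 := fun k l h0 ↦ by
    have := norm_natCast_add_three l
    rw [← h0, norm_unrolled, Real.exp_zero] at this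
    have : (0 : ℝ) ≤ l := by positivity
    linarith
  unfold puncture at h
  split_ifs at h with ha hb hb' ha' hb hb' hb hb'
  · omega
  · exact absurd h.symm (unrolled_ne_zero _ _ _)
  · exact absurd h.symm (nrm _)
  · exact absurd h (unrolled_ne_zero _ _ _)
  · obtain ⟨-, j, hj⟩ := (unrolled_eq_iff (by omega)).1 h
    have hj' : (a : ℤ) = b + m * j := by exact_mod_cast hj
    have e : (a : ℤ) % m = b % m := by rw [hj', Int.add_mul_emod_self_left]
    have e' : a % m = b % m := by exact_mod_cast e
    rwa [Nat.mod_eq_of_lt ha', Nat.mod_eq_of_lt hb'] at e'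
  · exact absurd h (far _ _)
  · exact absurd h (nrm _)
  · exact absurd h.symm (far _ _)
  · exact_mod_cast add_right_cancel h

theorem unrolled_mem_punctures {m e l : ℕ} (hm : 0 < m) (hl : ¬ m ∣ l) :
    unrolled m l 0 ∈ puncture m '' (Finset.range (m + e) : Set ℕ) := by
  have hlt := Nat.mod_lt l hm
  have hne : l % m ≠ 0 := fun h ↦ hl (Nat.dvd_of_mod_eq_zero h)
  refine ⟨l % m, by simp; omega, ?_⟩
  rw [puncture, if_neg hne, if_pos hlt, unrolled_eq_iff hm]
  refine ⟨rfl, -(l / m : ℕ), ?_⟩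
  have h2 : (l : ℝ) = m * (l / m : ℕ) + (l % m : ℕ) := by exact_mod_cast (Nat.div_add_mod l m).symm
  rw [Int.cast_neg, Int.cast_natCast]
  linarith

theorem one_notMem_punctures {m e : ℕ} (hm : 0 < m) :
    (1 : ℂ) ∉ puncture m '' (Finset.range (m + e) : Set ℕ) := by
  rintro ⟨l, -, h⟩
  have one : (1 : ℂ) = unrolled m 0 0 := by simp [unrolled]
  unfold puncture at h
  split_ifs at h with h0 h1
  · simp at h
  · rw [one, unrolled_eq_iff hm] at h
    obtain ⟨-, j, hj⟩ := h
    have hj' : (l : ℤ) = m * j := by exact_mod_cast (by simpa using hj : (l : ℝ) = m * j)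
    have hd : m ∣ l := by exact_mod_cast (Dvd.intro j hj'.symm : (m : ℤ) ∣ l)
    exact h0 (Nat.eq_zero_of_dvd_of_lt hd h1)
  · have := norm_natCast_add_three l
    rw [h, norm_one] at this
    have : (0 : ℝ) ≤ l := by positivity
    linarith

theorem IsProfile.natCast_ne {M : ℕ} {v : ℕ → ℝ} (hv : IsProfile M v) {l : ℕ} (h0 : 0 < l)
    (h1 : l < M) : linearInterp v M l ≠ 0 := by
  rw [linearInterp_natCast h1.le (by omega)]
  exact hv.ne_zero l h0 h1

theorem spiral_eq_unrolled_natCast {m r l : ℕ} {v : ℕ → ℝ} (hm : 0 < m)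
    (hr : 0 < r) (hv : IsProfile (m * r) v) {t : I} (h : spiral m r v t = unrolled m l 0) :
    (t = 0 ∨ t = 1) ∧ m ∣ l := by
  have hM : 0 < m * r := Nat.mul_pos hm hr
  unfold spiral at h
  rw [unrolled_eq_iff hm] at h
  obtain ⟨hy, j, hj⟩ := h
  have hint : ((m * r : ℕ) : ℝ) * t = ((l + m * j : ℤ) : ℝ) := by push_cast; exact_mod_cast hj
  have hnn : (0 : ℤ) ≤ l + m * j := by
    have : (0 : ℝ) ≤ ((l + m * j : ℤ) : ℝ) := by
      rw [← hint]; exact mul_nonneg (by positivity) t.2.1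
    exact_mod_cast this
  obtain ⟨q, hq⟩ := Int.eq_ofNat_of_zero_le hnn
  rw [hq, Int.cast_natCast] at hint
  rw [hint] at hy
  have hqM : q ≤ m * r := by
    have : (q : ℝ) ≤ (m * r : ℕ) := by
      rw [← hint]; exact mul_le_of_le_one_right (by positivity) t.2.2
    exact_mod_cast this
  have hM' : ((m * r : ℕ) : ℝ) ≠ 0 := by positivity
  have ends : q = 0 ∨ q = m * r := by
    by_contra! hne
    exact hv.natCast_ne (by omega) (by omega) hy
  have hdvd : m ∣ q := by rcases ends with rfl | rfl <;> simp
  constructor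
  · rcases ends with rfl | rfl
    · left
      apply Subtype.ext
      simpa [hm.ne', hr.ne'] using hint
    · right
      exact Subtype.ext (by simpa using mul_left_cancel₀ hM' (hint.trans (mul_one _).symm))
  · have h1 : (m : ℤ) ∣ (l : ℤ) := by
      have : (l : ℤ) = q - m * j := by linarith
      rw [this]
      exact dvd_sub (by exact_mod_cast hdvd) (dvd_mul_right _ _)
    exact_mod_cast h1

theorem spiral_notMem_punctures {m e r : ℕ} {v : ℕ → ℝ} (hm : 0 < m) (hr : 0 < r)
    (hv : IsProfile (m * r) v) (t : I) :
    spiral m r v t ∉ puncture m '' (Finset.range (m + e) : Set ℕ) := by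
  rintro ⟨l, -, h⟩
  unfold puncture at h
  split_ifs at h with h0 h1
  · exact unrolled_ne_zero _ _ _ h.symm
  · exact h0 (Nat.eq_zero_of_dvd_of_lt (spiral_eq_unrolled_natCast hm hr hv h.symm).2 h1)
  · have hn := norm_natCast_add_three l
    have hle : linearInterp v (m * r) ((m * r : ℕ) * t) ≤ 1 / 2 :=
      linearInterp_le_half hv.abs_le (mul_nonneg (by positivity) t.2.1)
        (mul_le_of_le_one_right (by positivity) t.2.2) (Nat.mul_pos hm hr)
    rw [h, spiral, norm_unrolled] at hn
    have h3 := Real.exp_le_exp.2 (hle.trans (by norm_num : (1 : ℝ) / 2 ≤ 1))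
    have h4 := Real.exp_one_lt_three
    have : (0 : ℝ) ≤ l := by positivity
    linarith

theorem spiral_ne_one {m r : ℕ} {v : ℕ → ℝ} (hm : 0 < m) (hr : 0 < r)
    (hv : IsProfile (m * r) v) {t : I} (h0 : t ≠ 0) (h1 : t ≠ 1) : spiral m r v t ≠ 1 := by
  intro h
  have one : (1 : ℂ) = unrolled m (0 : ℕ) 0 := by simp [unrolled]
  exact (spiral_eq_unrolled_natCast hm hr hv (h.trans one)).1.elim h0 h1

theorem spiral_zero {m r : ℕ} {v : ℕ → ℝ} (hm : 0 < m) (hr : 0 < r)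
    (hv : IsProfile (m * r) v) : spiral m r v 0 = 1 := by
  have := linearInterp_natCast (v := v) (Nat.zero_le (m * r)) (Nat.mul_pos hm hr)
  rw [hv.zero, Nat.cast_zero] at this
  simp [spiral, unrolled, this]

theorem spiral_one {m r : ℕ} {v : ℕ → ℝ} (hm : 0 < m) (hr : 0 < r)
    (hv : IsProfile (m * r) v) : spiral m r v 1 = 1 := by
  have h := linearInterp_natCast (v := v) le_rfl (Nat.mul_pos hm hr)
  rw [hv.last] at h
  have one : (1 : ℂ) = unrolled m 0 0 := by simp [unrolled]
  rw [spiral, mul_one, h, one, unrolled_eq_iff hm]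
  exact ⟨rfl, r, by push_cast; ring⟩

/-- The spiral as a loop at `1` in the complement of the punctures. -/
noncomputable def spiralLoop {m r : ℕ} {v : ℕ → ℝ} (e : ℕ) (hm : 0 < m) (hr : 0 < r)
    (hv : IsProfile (m * r) v) :
    Path (X := {z : ℂ // z ∉ puncture m '' (Finset.range (m + e) : Set ℕ)})
      ⟨1, one_notMem_punctures hm⟩ ⟨1, one_notMem_punctures hm⟩ where
  toFun t := ⟨spiral m r v t, spiral_notMem_punctures hm hr hv t⟩
  continuous_toFun := by
    have := continuous_spiral m r v
    fun_prop
  source' := Subtype.ext (by simpa using spiral_zero hm hr hv)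
  target' := Subtype.ext (by simpa using spiral_one hm hr hv)

theorem coe_spiralLoop {m r : ℕ} {v : ℕ → ℝ} (e : ℕ) (hm : 0 < m) (hr : 0 < r)
    (hv : IsProfile (m * r) v) (t : I) : (spiralLoop e hm hr hv t : ℂ) = spiral m r v t := rfl

theorem avoidsBase_spiralLoop {m r : ℕ} {v : ℕ → ℝ} (e : ℕ) (hm : 0 < m) (hr : 0 < r)
    (hv : IsProfile (m * r) v) : AvoidsBase (spiralLoop e hm hr hv) :=
  fun _ h0 h1 ↦ spiral_ne_one hm hr hv h0 h1

/-- The lift of a spiral through `exp`. -/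
noncomputable def spiralLift (m r : ℕ) (v : ℕ → ℝ) : C(I, ℂ) where
  toFun t := linearInterp v (m * r) ((m * r : ℕ) * t) +
    (2 * Real.pi * ((m * r : ℕ) * t / m) : ℝ) * Complex.I
  continuous_toFun := by
    have := continuous_linearInterp v (m * r)
    fun_prop

theorem exp_spiralLift (m r : ℕ) (v : ℕ → ℝ) (t : I) :
    Complex.exp (spiralLift m r v t) = spiral m r v t := rfl

theorem spiralLift_zero {m r : ℕ} {v : ℕ → ℝ} (hm : 0 < m) (hr : 0 < r)
    (hv : IsProfile (m * r) v) : spiralLift m r v 0 = 0 := by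
  have := linearInterp_natCast (v := v) (Nat.zero_le (m * r)) (Nat.mul_pos hm hr)
  rw [hv.zero, Nat.cast_zero] at this
  simp [spiralLift, this]

theorem spiralLift_one {m r : ℕ} {v : ℕ → ℝ} (hm : 0 < m) (hr : 0 < r)
    (hv : IsProfile (m * r) v) : spiralLift m r v 1 = (2 * Real.pi * r : ℝ) * Complex.I := by
  have h := linearInterp_natCast (v := v) le_rfl (Nat.mul_pos hm hr)
  rw [hv.last] at h
  have hm' : (m : ℝ) ≠ 0 := by positivity
  change (linearInterp v (m * r) ((m * r : ℕ) * 1) : ℂ) +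
    (2 * Real.pi * ((m * r : ℕ) * 1 / m) : ℝ) * Complex.I = _
  rw [mul_one, h]
  have : ((m * r : ℕ) : ℝ) / m = r := by push_cast; field_simp
  rw [this]
  simp

theorem spiralLift_re_of_im_eq {m r l : ℕ} {v : ℕ → ℝ} (hm : 0 < m) (h1 : l < m * r)
    {t : I} (h : (spiralLift m r v t).im = 2 * Real.pi * (l / m)) :
    (spiralLift m r v t).re = v l := by
  have hm' : (m : ℝ) ≠ 0 := by positivity
  have him : (spiralLift m r v t).im = 2 * Real.pi * ((m * r : ℕ) * t / m) := by
    simp [spiralLift]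
  have hre : (spiralLift m r v t).re = linearInterp v (m * r) ((m * r : ℕ) * t) := by
    simp [spiralLift]
  rw [him] at h
  have h2 := mul_left_cancel₀ (by positivity) h
  have h3 : ((m * r : ℕ) : ℝ) * t = l := by field_simp at h2; exact h2
  rw [hre, h3, linearInterp_natCast h1.le (by omega)]

/-- Homotopic spirals have the same number of turns and do not pass on different sides of
a puncture. -/
theorem homotopic_spiralLoop {m r r' e : ℕ} {v v' : ℕ → ℝ} (hm : 0 < m) (hr : 0 < r)
    (hr' : 0 < r') (hv : IsProfile (m * r) v) (hv' : IsProfile (m * r') v')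
    (h : (spiralLoop e hm hr hv).Homotopic (spiralLoop e hm hr' hv')) :
    r = r' ∧ ∀ l < m * r, ¬ m ∣ l → 0 < v l → ¬ v' l < 0 := by
  obtain ⟨H⟩ := h
  let K : C(I × I, ℂ) := ⟨fun p ↦ (H p : ℂ), by fun_prop⟩
  have hK0 : ∀ p, K p ≠ 0 := fun p h0 ↦
    (H p).2 ⟨0, by simp [hm], by rw [puncture, if_pos rfl]; exact h0.symm⟩
  obtain ⟨L, hexp, hL0, hL1, hleft, hright⟩ := exists_lift_exp_of_homotopy K hK0
    (spiralLift m r v) (spiralLift m r' v')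
    (fun t ↦ by rw [exp_spiralLift, ← coe_spiralLoop e hm hr hv]; simp [K])
    (fun t ↦ by rw [exp_spiralLift, ← coe_spiralLoop e hm hr' hv']; simp [K])
    (by rw [spiralLift_zero hm hr hv, spiralLift_zero hm hr' hv'])
    (fun s ↦ by simp [K]) (fun s ↦ by simp [K])
  have hrr : r = r' := by
    have h1 := hright 1
    rw [hL1, spiralLift_one hm hr hv, spiralLift_one hm hr' hv'] at h1
    have h2 := congrArg Complex.im h1
    simp [Real.pi_ne_zero] at h2
    exact h2.symm
  subst hrr
  refine ⟨rfl, fun l hl hdvd hpos hneg ↦ ?_⟩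
  have hl0 : 0 < l := Nat.pos_of_ne_zero fun h0 ↦ hdvd (h0 ▸ dvd_zero m)
  rw [spiralLift_zero hm hr hv] at hleft
  let c : ℂ := (2 * Real.pi * (l / m) : ℝ) * Complex.I
  have hm' : (0 : ℝ) < m := by positivity
  have hcre : c.re = 0 := by simp [c]
  have hcim : c.im = 2 * Real.pi * (l / m) := by simp [c]
  refine not_exists_homotopy_across_zero (⟨fun p ↦ L p - c, by fun_prop⟩ : C(I × I, ℂ)) ?_
    (a := 2 * Real.pi * (l / m)) (b := 2 * Real.pi * r - 2 * Real.pi * (l / m))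
    (by positivity) ?_ ?_ ?_ ?_ ?_
  · intro p h0
    have h1 : L p = c := sub_eq_zero.1 h0
    have h2 := hexp p
    rw [h1] at h2
    refine (H p).2 ?_
    convert unrolled_mem_punctures (e := e) hm hdvd using 1
    rw [unrolled]
    simpa [c, K] using h2.symm
  · have : (l : ℝ) / m < r := by
      rw [div_lt_iff₀ hm', mul_comm]; exact_mod_cast hl
    nlinarith [Real.pi_pos]
  · intro t
    change L (0, t) - c ∈ _
    rw [hL0, Complex.mem_slitPlane_iff, Complex.sub_re, Complex.sub_im, hcre, hcim, sub_zero]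
    by_cases him : (spiralLift m r v t).im = 2 * Real.pi * (l / m)
    · left; rwa [spiralLift_re_of_im_eq hm hl him]
    · right; exact sub_ne_zero.2 him
  · intro t
    change -(L (1, t) - c) ∈ _
    rw [hL1, Complex.mem_slitPlane_iff, Complex.neg_re, Complex.neg_im, Complex.sub_re,
      Complex.sub_im, hcre, hcim, sub_zero]
    by_cases him : (spiralLift m r v' t).im = 2 * Real.pi * (l / m)
    · left; rw [spiralLift_re_of_im_eq hm hl him]; linarith
    · right; exact neg_ne_zero.2 (sub_ne_zero.2 him)
  · intro s
    change L (s, 0) - c = _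
    rw [hleft]; simp [c]
  · intro s
    change L (s, 1) - c = _
    rw [hright, spiralLift_one hm hr hv]; simp [c]; ring

theorem crossingsLt_spiralLoop {m r r' e k : ℕ} {v v' : ℕ → ℝ} (hm : 0 < m) (hr : 0 < r)
    (hr' : 0 < r') (hv : IsProfile (m * r) v) (hv' : IsProfile (m * r') v') (hm2 : 2 ≤ m)
    (hne : ∀ l l', v l = v' l' → l = 0 ∨ m * r ≤ l) (hk : m * (r * r') < k + 2) :
    CrossingsLt (spiralLoop e hm hr hv) (spiralLoop e hm hr' hv') k := by
  have hM : m ≤ m * r := Nat.le_mul_of_pos_right m hr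
  let T : Finset ((ℕ × ℕ) × ℕ) :=
    ((Finset.range r ×ˢ Finset.range r') ×ˢ Finset.range m) \
      {((0, 0), 0), ((r - 1, r' - 1), m - 1)}
  have hT : T.card < k := by
    rw [Finset.card_sdiff_of_subset]
    · rw [Finset.card_pair (by simp only [ne_eq, Prod.mk.injEq]; omega), Finset.card_product,
        Finset.card_product, Finset.card_range, Finset.card_range, Finset.card_range, mul_comm]
      have : 2 ≤ m * (r * r') := hm2.trans (Nat.le_mul_of_pos_right m (Nat.mul_pos hr hr'))
      omega
    · intro q hq
      simp only [Finset.mem_insert, Finset.mem_singleton] at hq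
      rcases hq with rfl | rfl <;> simp only [Finset.mem_product, Finset.mem_range] <;> omega
  refine lt_of_le_of_lt (encard_le_card_of_cells (v := v) (v' := v') (T := T) hm hr hr' ?_)
    (Nat.cast_lt.2 hT)
  rintro ⟨s, t⟩ ⟨hs0, hs1, ht0, ht1, hst⟩
  obtain ⟨l, l', τ, hl, hl', h0, h1, e1, e2, hmod, heq, hz⟩ :=
    exists_cells_of_spiral_eq (v := v) (v' := v') hm hr hr' hs0 hs1 ht0 ht1
      (congrArg Subtype.val hst)
  refine ⟨l, l', τ, h0, h1, e1, e2, hmod, heq, ?_, ?_⟩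
  · rintro ⟨ha, hb⟩
    have := hne _ _ ha
    have := hne _ _ hb
    omega
  · simp only [T, Finset.mem_sdiff, Finset.mem_product, Finset.mem_range, Finset.mem_insert,
      Finset.mem_singleton, Prod.mk.injEq, not_or]
    refine ⟨⟨⟨Nat.div_lt_of_lt_mul hl, Nat.div_lt_of_lt_mul hl'⟩, Nat.mod_lt _ hm⟩, ?_, ?_⟩
    · rintro ⟨⟨hd, hd'⟩, hz0⟩
      obtain rfl : l = 0 := by rw [← Nat.div_add_mod l m, hd, hz0, mul_zero]
      obtain rfl : l' = 0 := by rw [← Nat.div_add_mod l' m, hd', ← hmod, hz0, mul_zero]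
      have hτ : τ ≠ 0 := fun h ↦ hz h rfl
      rw [hv.zero, hv'.zero, mul_zero, zero_add, zero_add, zero_add] at heq
      have := hne _ _ (mul_left_cancel₀ hτ heq)
      omega
    · rintro ⟨⟨hd, hd'⟩, hz0⟩
      have el : l + 1 = m * r := by
        obtain ⟨r, rfl⟩ := Nat.exists_eq_add_of_lt hr
        have := Nat.div_add_mod l m
        rw [hd, hz0, zero_add, Nat.add_sub_cancel] at this
        rw [zero_add, mul_add]; omega
      have el' : l' + 1 = m * r' := by
        obtain ⟨r', rfl⟩ := Nat.exists_eq_add_of_lt hr'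
        have := Nat.div_add_mod l' m
        rw [hd', ← hmod, hz0, zero_add, Nat.add_sub_cancel] at this
        rw [zero_add, mul_add]; omega
      rw [el, el', hv.last, hv'.last, mul_zero, add_zero, add_zero] at heq
      have := hne _ _ (mul_left_cancel₀ (by linarith) heq)
      omega

theorem selfIntersLt_spiralLoop {m r e k : ℕ} {v : ℕ → ℝ} (hm : 0 < m) (hr : 0 < r)
    (hv : IsProfile (m * r) v) (hm2 : 2 ≤ m)
    (hne : ∀ l l', v l = v l' → l ≠ l' → l = 0 ∨ m * r ≤ l) (hk : m * (r * (r - 1)) < k) :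
    SelfIntersLt (spiralLoop e hm hr hv) k := by
  have hM : m ≤ m * r := Nat.le_mul_of_pos_right m hr
  let T : Finset ((ℕ × ℕ) × ℕ) := (Finset.range r).offDiag ×ˢ Finset.range m
  have hT : T.card < k := by
    rw [Finset.card_product, Finset.offDiag_card, Finset.card_range, Finset.card_range, mul_comm,
      ← Nat.mul_sub_one]
    exact hk
  refine lt_of_le_of_lt (encard_le_card_of_cells (v := v) (v' := v) (T := T) hm hr hr ?_)
    (Nat.cast_lt.2 hT)
  rintro ⟨s, t⟩ ⟨hs0, ht1, hlt, hst⟩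
  have hs1 : s ≠ 1 := (hlt.trans_le unitInterval.le_one').ne
  have ht0 : t ≠ 0 := (unitInterval.nonneg'.trans_lt hlt).ne'
  obtain ⟨l, l', τ, hl, hl', h0, h1, e1, e2, hmod, heq, hz⟩ :=
    exists_cells_of_spiral_eq (v := v) (v' := v) hm hr hr hs0 hs1 ht0 ht1
      (congrArg Subtype.val hst)
  have hll : l ≠ l' := by
    rintro rfl
    have hM' : ((m * r : ℕ) : ℝ) ≠ 0 := by positivity
    exact hlt.ne (Subtype.ext (mul_left_cancel₀ hM' (e1.trans e2.symm)))
  refine ⟨l, l', τ, h0, h1, e1, e2, hmod, heq, ?_, ?_⟩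
  · rintro ⟨ha, hb⟩
    have := hne _ _ ha hll
    have := hne _ _ hb (by omega)
    omega
  · simp only [T, Finset.mem_product, Finset.mem_offDiag, Finset.mem_range]
    refine ⟨⟨Nat.div_lt_of_lt_mul hl, Nat.div_lt_of_lt_mul hl', fun hd ↦ hll ?_⟩,
      Nat.mod_lt _ hm⟩
    rw [← Nat.div_add_mod l m, ← Nat.div_add_mod l' m, hd, hmod]

/-- The heights of the `i`-th spiral of a family: signs given by `b`, all magnitudes distinct. -/
noncomputable def signedHeight (M i : ℕ) (b : ℕ → Bool) (l : ℕ) : ℝ :=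
  if l = 0 ∨ M ≤ l then 0 else (if b l then 1 else -1) * (2 + (Nat.pair i l : ℝ))⁻¹

theorem signedHeight_of_pos_of_lt {M l : ℕ} (i : ℕ) (b : ℕ → Bool) (h0 : 0 < l) (h1 : l < M) :
    signedHeight M i b l = (if b l then 1 else -1) * (2 + (Nat.pair i l : ℝ))⁻¹ :=
  if_neg (by omega)

theorem abs_signedHeight {M l : ℕ} (i : ℕ) (b : ℕ → Bool) (h0 : 0 < l) (h1 : l < M) :
    |signedHeight M i b l| = (2 + (Nat.pair i l : ℝ))⁻¹ := by
  rw [signedHeight_of_pos_of_lt i b h0 h1, abs_mul, abs_of_pos (a := (2 + (Nat.pair i l : ℝ))⁻¹)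
    (by positivity)]
  split_ifs <;> simp

theorem isProfile_signedHeight (M i : ℕ) (b : ℕ → Bool) : IsProfile M (signedHeight M i b) where
  zero := by simp [signedHeight]
  last := by simp [signedHeight]
  ne_zero l h0 h1 := by
    rw [← abs_pos, abs_signedHeight i b h0 h1]
    positivity
  abs_le l := by
    by_cases h : l = 0 ∨ M ≤ l
    · simp [signedHeight, h]
    · rw [abs_signedHeight i b (by omega) (by omega), one_div]
      gcongr
      have : (0 : ℝ) ≤ Nat.pair i l := by positivity
      linarith

theorem signedHeight_eq {M M' i j l l' : ℕ} {b b' : ℕ → Bool}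
    (h : signedHeight M i b l = signedHeight M' j b' l') (hij : i = j → l ≠ l') :
    l = 0 ∨ M ≤ l := by
  by_contra hl
  have hpos := (isProfile_signedHeight M i b).ne_zero l (by omega) (by omega)
  by_cases hl' : l' = 0 ∨ M' ≤ l'
  · exact hpos (by rw [h, signedHeight, if_pos hl'])
  · have h2 := congrArg abs h
    rw [abs_signedHeight i b (by omega) (by omega), abs_signedHeight j b' (by omega) (by omega),
      inv_inj, add_right_inj, Nat.cast_inj, Nat.pair_eq_pair] at h2
    exact hij h2.1 h2.2

/-- Families of pairwise non-homotopic spirals with few crossings. -/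
theorem exists_spiral_family {m e k N : ℕ} (hm : 2 ≤ m) (r : ℕ → ℕ) (hr : ∀ i, 0 < r i)
    (b : ℕ → ℕ → Bool)
    (hb : ∀ i < N, ∀ j < N, i ≠ j → r i = r j → ∃ l < m * r i, ¬ m ∣ l ∧ b i l ≠ b j l)
    (hself : ∀ i < N, m * (r i * (r i - 1)) < k)
    (hcross : ∀ i < N, ∀ j < N, i ≠ j → m * (r i * r j) < k + 2) :
    ∃ (A : Set ℂ) (_ : A.Finite) (_ : A.ncard = m + e) (x : ℂ) (hx : x ∉ A)
      (γ : Fin N → Path (X := {z : ℂ // z ∉ A}) ⟨x, hx⟩ ⟨x, hx⟩),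
      (∀ i j, i ≠ j → ¬ (γ i).Homotopic (γ j)) ∧
      (∀ i, AvoidsBase (γ i)) ∧
      (∀ i, SelfIntersLt (γ i) k) ∧
      (∀ i j, i ≠ j → CrossingsLt (γ i) (γ j) k) := by
  have hm0 : 0 < m := by omega
  have prof (i : Fin N) := isProfile_signedHeight (m * r i) i (b i)
  refine ⟨puncture m '' (Finset.range (m + e) : Set ℕ), (Finset.finite_toSet _).image _, ?_, 1,
    one_notMem_punctures hm0, fun i ↦ spiralLoop e hm0 (hr i) (prof i), ?_, ?_, ?_, ?_⟩
  · rw [Set.ncard_image_of_injective _ puncture_injective, Set.ncard_coe_finset, Finset.card_range]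
  · intro i j hij h
    obtain ⟨hrr, h1⟩ := homotopic_spiralLoop hm0 (hr i) (hr j) (prof i) (prof j) h
    obtain ⟨-, h2⟩ := homotopic_spiralLoop hm0 (hr j) (hr i) (prof j) (prof i) h.symm
    obtain ⟨l, hl, hdvd, hbl⟩ := hb i i.2 j j.2 (Fin.val_ne_of_ne hij) hrr
    have hl0 : 0 < l := Nat.pos_of_ne_zero fun h0 ↦ hdvd (h0 ▸ dvd_zero m)
    replace h1 := h1 l hl hdvd
    replace h2 := h2 l (hrr ▸ hl) hdvd
    rw [signedHeight_of_pos_of_lt _ _ hl0 hl, signedHeight_of_pos_of_lt _ _ hl0 (hrr ▸ hl)]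
      at h1 h2
    have p1 : (0 : ℝ) < (2 + (Nat.pair i l : ℝ))⁻¹ := by positivity
    have p2 : (0 : ℝ) < (2 + (Nat.pair j l : ℝ))⁻¹ := by positivity
    rcases Bool.eq_false_or_eq_true (b i l) with hi | hi <;>
      rcases Bool.eq_false_or_eq_true (b j l) with hj | hj
    · exact hbl (hi.trans hj.symm)
    · simp only [hi, hj] at h1
      exact h1 (by simpa using p1) (by simpa using p2)
    · simp only [hi, hj] at h2
      exact h2 (by simpa using p2) (by simpa using p1)
    · exact hbl (hi.trans hj.symm)
  · exact fun i ↦ avoidsBase_spiralLoop e hm0 (hr i) (prof i)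
  · exact fun i ↦ selfIntersLt_spiralLoop hm0 (hr i) (prof i) hm
      (fun l l' h hne ↦ signedHeight_eq h fun _ ↦ hne) (hself i i.2)
  · exact fun i j hij ↦ crossingsLt_spiralLoop hm0 (hr i) (hr j) (prof i) (prof j) hm
      (fun l l' h ↦ signedHeight_eq h fun h' ↦ absurd (Fin.ext h') hij)
      (hcross i i.2 j j.2 (Fin.val_ne_of_ne hij))

/-- The position in the `q`-th cell boundary not divisible by `p + 1`. -/
theorem nonmultiple_position {p q R : ℕ} (hp : 0 < p) (hq : q < p * R) :
    (p + 1) * (q / p) + q % p + 1 < (p + 1) * R ∧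
      ¬ (p + 1) ∣ (p + 1) * (q / p) + q % p + 1 ∧
      p * (((p + 1) * (q / p) + q % p + 1) / (p + 1)) +
        (((p + 1) * (q / p) + q % p + 1) % (p + 1) - 1) = q := by
  have hlt := Nat.mod_lt q hp
  have hdiv : q / p < R := Nat.div_lt_of_lt_mul hq
  have e1 : ((p + 1) * (q / p) + q % p + 1) / (p + 1) = q / p := by
    rw [add_assoc, Nat.mul_add_div (show 0 < p + 1 by omega),
      Nat.div_eq_of_lt (show q % p + 1 < p + 1 by omega), add_zero]
  have e2 : ((p + 1) * (q / p) + q % p + 1) % (p + 1) = q % p + 1 := by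
    rw [add_assoc, Nat.mul_add_mod, Nat.mod_eq_of_lt (by omega)]
  refine ⟨?_, ?_, ?_⟩
  · have : (p + 1) * (q / p + 1) ≤ (p + 1) * R := Nat.mul_le_mul_left _ hdiv
    rw [mul_add] at this
    omega
  · rw [Nat.dvd_iff_mod_eq_zero, e2]
    omega
  · rw [e1, e2, Nat.add_sub_cancel, Nat.div_add_mod]

/-- All `2 ^ (p * R)` spirals with `R` turns around `p + 1` punctures. -/
theorem exists_two_pow_spirals {p R e k : ℕ} (hp : 0 < p) (hR : 0 < R)
    (hk : (p + 1) * (R * R) < k + 2) :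
    ∃ (A : Set ℂ) (_ : A.Finite) (_ : A.ncard = p + 1 + e) (x : ℂ) (hx : x ∉ A)
      (γ : Fin (2 ^ (p * R)) → Path (X := {z : ℂ // z ∉ A}) ⟨x, hx⟩ ⟨x, hx⟩),
      (∀ i j, i ≠ j → ¬ (γ i).Homotopic (γ j)) ∧
      (∀ i, AvoidsBase (γ i)) ∧
      (∀ i, SelfIntersLt (γ i) k) ∧
      (∀ i j, i ≠ j → CrossingsLt (γ i) (γ j) k) := by
  refine exists_spiral_family (by omega) (fun _ ↦ R) (fun _ ↦ hR)
    (fun i l ↦ i.testBit (p * (l / (p + 1)) + (l % (p + 1) - 1))) ?_ ?_ fun _ _ _ _ _ ↦ hk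
  · intro i hi j hj hij _
    obtain ⟨q, hq⟩ := Nat.exists_testBit_ne_of_ne hij
    have hqlt : q < p * R := by
      by_contra! hle
      have h2 := Nat.pow_le_pow_right (n := 2) (by norm_num) hle
      exact hq (by rw [Nat.testBit_lt_two_pow (hi.trans_le h2),
        Nat.testBit_lt_two_pow (hj.trans_le h2)])
    obtain ⟨h1, h2, h3⟩ := nonmultiple_position hp hqlt
    exact ⟨_, h1, h2, by rwa [h3]⟩
  · intro i _
    obtain ⟨R, rfl⟩ := Nat.exists_eq_add_of_lt hR
    have h1 : (p + 1) * ((0 + R + 1) * (0 + R + 1)) =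
      (p + 1) * ((0 + R + 1) * R) + (p + 1) * (0 + R + 1) := by ring
    have h2 : 2 * 1 ≤ (p + 1) * (0 + R + 1) := Nat.mul_le_mul (by omega) (by omega)
    simp only [Nat.add_sub_cancel]
    rw [zero_add] at *
    omega

theorem sqrt_div_three_le {a c : ℕ} (h : a ≤ 9 * c ^ 2) : Real.sqrt a / 3 ≤ c := by
  have h' : (a : ℝ) ≤ 9 * c ^ 2 := by exact_mod_cast h
  rw [div_le_iff₀ (by norm_num), Real.sqrt_le_left (by positivity)]
  linarith

theorem two_rpow_le_two_pow {n k c : ℕ} (h : n * k ≤ 9 * c ^ 2) :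
    (2 : ℝ) ^ (Real.sqrt ((n : ℝ) * k) / 3) ≤ ((2 ^ c : ℕ) : ℝ) := by
  have := sqrt_div_three_le h
  push_cast at this ⊢
  rw [← Real.rpow_natCast]
  exact Real.rpow_le_rpow_of_exponent_le (by norm_num) this

theorem two_rpow_le_three {k : ℕ} (hk : k ≤ 6) :
    (2 : ℝ) ^ (Real.sqrt ((2 : ℕ) * (k : ℝ)) / 3) ≤ 3 := by
  have hk' : (k : ℝ) ≤ 6 := by exact_mod_cast hk
  have h1 : Real.sqrt ((2 : ℕ) * (k : ℝ)) / 3 ≤ 3 / 2 := by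
    rw [div_le_iff₀ (by norm_num), Real.sqrt_le_left (by norm_num)]
    push_cast
    linarith
  calc (2 : ℝ) ^ (Real.sqrt ((2 : ℕ) * (k : ℝ)) / 3) ≤ 2 ^ (3 / 2 : ℝ) :=
        Real.rpow_le_rpow_of_exponent_le (by norm_num) h1
    _ ≤ 3 := by
      have h2 : ((2 : ℝ) ^ (3 / 2 : ℝ)) ^ 2 = 8 := by
        rw [← Real.rpow_natCast, ← Real.rpow_mul (by norm_num)]
        norm_num
      nlinarith [Real.rpow_pos_of_pos (show (0 : ℝ) < 2 by norm_num) (3 / 2)]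

/-- Rounds `R` such that the spirals have few crossings but enough turns. -/
theorem exists_rounds {n k : ℕ} (hn : 2 ≤ n) (hnk : n ≤ k + 1) (hex : n = 2 → k ≠ 5 ∧ k ≠ 6) :
    ∃ R, 0 < R ∧ n * (R * R) < k + 2 ∧ n * k ≤ 9 * ((n - 1) * R) ^ 2 := by
  obtain ⟨R, hR1, hR2, hR0⟩ : ∃ R, R * R ≤ (k + 1) / n ∧ (k + 1) / n < (R + 1) * (R + 1) ∧ 0 < R :=
    ⟨_, Nat.sqrt_le _, Nat.lt_succ_sqrt _,
      Nat.sqrt_pos.2 ((Nat.one_le_div_iff (by omega)).2 hnk)⟩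
  have h1 : n * (R * R) ≤ k + 1 := by
    rw [mul_comm]; exact (Nat.le_div_iff_mul_le (by omega)).1 hR1
  have h2 : k + 1 < (R + 1) * (R + 1) * n := (Nat.div_lt_iff_lt_mul (by omega)).1 hR2
  refine ⟨R, hR0, by omega, ?_⟩
  obtain ⟨p, rfl⟩ : ∃ p, n = p + 1 := ⟨n - 1, by omega⟩
  rw [Nat.add_sub_cancel]
  rcases Nat.eq_or_lt_of_le hn with h | h
  · obtain rfl : p = 1 := by omega
    rcases Nat.eq_or_lt_of_le (show 1 ≤ R from hR0) with h | h
    · subst h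
      have := hex rfl
      omega
    · obtain ⟨S, rfl⟩ := Nat.exists_eq_add_of_le h
      nlinarith
  · have h3 : k ≤ 4 * (R * R) * (p + 1) := by
      have : (R + 1) * (R + 1) ≤ 4 * (R * R) := by nlinarith
      have := Nat.mul_le_mul_right (p + 1) this
      omega
    have h4 : (p + 1) * 2 ≤ 3 * p := by omega
    calc (p + 1) * k ≤ (p + 1) * (4 * (R * R) * (p + 1)) := Nat.mul_le_mul_left _ h3
      _ = ((p + 1) * 2) * ((p + 1) * 2) * (R * R) := by ring
      _ ≤ (3 * p) * (3 * p) * (R * R) := Nat.mul_le_mul_right _ (Nat.mul_le_mul h4 h4)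
      _ = 9 * (p * R) ^ 2 := by ring

/-- (`f(n,k) ≥ 2^{√(nk)/3}` for `2 ≤ n ≤ 2k`.) -/
theorem loops_lower_bound_small_n (n k : ℕ) (hn : 2 ≤ n) (hk : 1 ≤ k) (hnk : n ≤ 2 * k) :
    ∃ (A : Set ℂ) (_ : A.Finite) (_ : A.ncard = n) (x : ℂ) (hx : x ∉ A) (N : ℕ)
      (γ : Fin N → Path (X := {z : ℂ // z ∉ A}) ⟨x, hx⟩ ⟨x, hx⟩),
      (2 : ℝ) ^ (Real.sqrt ((n : ℝ) * k) / 3) ≤ (N : ℝ) ∧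
      (∀ i j, i ≠ j → ¬ (γ i).Homotopic (γ j)) ∧
      (∀ i, AvoidsBase (γ i)) ∧
      (∀ i, SelfIntersLt (γ i) k) ∧
      (∀ i j, i ≠ j → CrossingsLt (γ i) (γ j) k) := by
  rcases lt_or_ge (k + 1) n with hlt | hge
  · obtain ⟨A, hA, hcard, x, hx, γ, hγ⟩ :=
      exists_two_pow_spirals (p := k) (R := 1) (e := n - (k + 1)) (k := k) hk one_pos (by omega)
    exact ⟨A, hA, by omega, x, hx, _, γ, two_rpow_le_two_pow (by nlinarith), hγ⟩
  by_cases hex : n = 2 ∧ (k = 5 ∨ k = 6)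
  · obtain ⟨rfl, hk56⟩ := hex
    obtain ⟨A, hA, hcard, x, hx, γ, hγ⟩ := exists_spiral_family (m := 2) (e := 0) (k := k) (N := 3)
      le_rfl (fun i ↦ if i = 2 then 2 else 1) (fun i ↦ by split_ifs <;> norm_num)
      (fun i _ ↦ i = 1)
      (fun i hi j hj hij hr ↦ ⟨1, by split_ifs <;> norm_num, by norm_num, by
        interval_cases i <;> interval_cases j <;> simp_all⟩)
      (fun i hi ↦ by split_ifs <;> omega)
      (fun i hi j hj hij ↦ by split_ifs <;> omega)
    exact ⟨A, hA, hcard, x, hx, 3, γ, by exact_mod_cast two_rpow_le_three (by omega), hγ⟩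
  · obtain ⟨R, hR, h1, h2⟩ := exists_rounds hn hge (by omega)
    obtain ⟨p, rfl⟩ : ∃ p, n = p + 1 := ⟨n - 1, by omega⟩
    obtain ⟨A, hA, hcard, x, hx, γ, hγ⟩ :=
      exists_two_pow_spirals (p := p) (R := R) (e := 0) (k := k) (by omega) hR h1
    exact ⟨A, hA, hcard, x, hx, _, γ, two_rpow_le_two_pow h2, hγ⟩
end

section
/- For every integer n ≥ 2 there exist a set A ⊆ ℂ of n distinct points, a point x ∈ ℂ \ A, and 2^n pairwise non-homotopic x-loops in the complement of A such that none of them passes through x, each has fewer than n self-intersections, and every pair of them cross fewer than n times. (In the paper's notation, f(n,n) ≥ 2^n.) -/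
open unitInterval

/-- Two homotopic paths, pulled along a nonvanishing function, have the same increment of any
continuous choice of logarithm. -/
theorem log_increment_eq_of_homotopic {X : Type*} [TopologicalSpace X] {x y : X} {p q : Path x y}
    (h : p.Homotopic q) {f : X → ℂ} (hf : Continuous f) (hf0 : ∀ z, f z ≠ 0)
    {L M : I → ℂ} (hL : Continuous L) (hM : Continuous M)
    (hLp : ∀ t, Complex.exp (L t) = f (p t)) (hMq : ∀ t, Complex.exp (M t) = f (q t)) :
    L 1 - L 0 = M 1 - M 0 := by
  let F : C(X, {z : ℂ // z ≠ 0}) := ⟨fun z => ⟨f z, hf0 z⟩, hf.subtype_mk _⟩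
  have hF : (F.comp p.toContinuousMap).HomotopicRel (F.comp q.toContinuousMap) {0, 1} :=
    let ⟨H⟩ := h
    ⟨ContinuousMap.HomotopyRel.compContinuousMap H F⟩
  have h0 : Complex.exp (L 0) = Complex.exp (M 0) := by
    rw [hLp, hMq, p.source, q.source]
  have cov := Complex.isCoveringMap_exp
  have hp0 : F.comp p.toContinuousMap 0 = ⟨_, (L 0).exp_ne_zero⟩ := Subtype.ext (hLp 0).symm
  have hq0 : F.comp q.toContinuousMap 0 = ⟨_, (L 0).exp_ne_zero⟩ :=
    Subtype.ext ((hMq 0).symm.trans h0.symm)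
  have key := cov.liftPath_apply_one_eq_of_homotopicRel hF (L 0) hp0 hq0
  have e1 := (cov.eq_liftPath_iff (Γ := L) hp0).2
    ⟨hL, funext fun t => Subtype.ext (hLp t), rfl⟩
  have e2 := (cov.eq_liftPath_iff (Γ := fun t => M t + (L 0 - M 0)) hq0).2
    ⟨by fun_prop, funext fun t => Subtype.ext (by
      change Complex.exp (M t + (L 0 - M 0)) = f (q t)
      rw [Complex.exp_add, Complex.exp_sub, h0, div_self (Complex.exp_ne_zero _), mul_one, hMq]),
      by ring⟩
  rw [← e1, ← e2] at key
  linear_combination key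

/-- The point with polar coordinates `exp r` and `2 * π * t`. -/
noncomputable def polarPoint (r t : ℝ) : ℂ := Complex.exp (r + 2 * Real.pi * t * Complex.I)

theorem polarPoint_re (r t : ℝ) :
    (polarPoint r t).re = Real.exp r * Real.cos (2 * Real.pi * t) := by
  simp [polarPoint, Complex.exp_re]

theorem polarPoint_im (r t : ℝ) :
    (polarPoint r t).im = Real.exp r * Real.sin (2 * Real.pi * t) := by
  simp [polarPoint, Complex.exp_im]

theorem polarPoint_zero_zero : polarPoint 0 0 = 1 := by simp [polarPoint]

theorem polarPoint_add_one (r t : ℝ) : polarPoint r (t + 1) = polarPoint r t := by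
  apply Complex.ext <;> simp [polarPoint_re, polarPoint_im, mul_add]

theorem polarPoint_mul (r s t u : ℝ) :
    polarPoint r t * polarPoint s u = polarPoint (r + s) (t + u) := by
  simp only [polarPoint, ← Complex.exp_add]
  push_cast
  ring_nf

theorem continuous_polarPoint : Continuous fun p : ℝ × ℝ => polarPoint p.1 p.2 := by
  unfold polarPoint
  fun_prop

theorem polarPoint_inj {r s t u : ℝ} (h : polarPoint r t = polarPoint s u)
    (htu : |t - u| < 1) : r = s ∧ t = u := by
  obtain ⟨k, hk⟩ := Complex.exp_eq_exp_iff_exists_int.1 h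
  have hre := congrArg Complex.re hk
  have him := congrArg Complex.im hk
  simp at hre him
  have h2 : t - u = k := by
    have := Real.pi_pos
    have h3 : (2 * Real.pi) * (t - u) = (2 * Real.pi) * k := by linear_combination him
    exact mul_left_cancel₀ (by positivity) h3
  rw [h2] at htu
  have hk0 : k = 0 := by
    rw [← Int.abs_lt_one_iff]
    exact_mod_cast htu
  rw [hk0] at h2
  exact ⟨hre, by simpa [sub_eq_zero] using h2⟩

theorem one_sub_polarPoint_mem_slitPlane {r u : ℝ} (hu : |u| < 1) (hr : u = 0 → r < 0) :
    1 - polarPoint r u ∈ Complex.slitPlane := by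
  rw [Complex.mem_slitPlane_iff]
  by_contra! hcon
  obtain ⟨h1, h2⟩ := hcon
  simp only [Complex.sub_re, Complex.sub_im, Complex.one_re, Complex.one_im, polarPoint_re,
    polarPoint_im, zero_sub, neg_eq_zero, mul_eq_zero, (Real.exp_pos r).ne', false_or] at h1 h2
  have hpi := Real.pi_pos
  obtain ⟨hu1, hu2⟩ := abs_lt.1 hu
  have hcos : 0 < Real.cos (2 * Real.pi * u) := by
    by_contra! hc
    nlinarith [Real.exp_pos r]
  have hcos1 : Real.cos (2 * Real.pi * u) = 1 := by
    have := Real.sin_sq_add_cos_sq (2 * Real.pi * u)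
    rw [h2] at this
    nlinarith
  have hu0 : u = 0 := by
    have := (Real.cos_eq_one_iff_of_lt_of_lt (by nlinarith) (by nlinarith)).1 hcos1
    simpa [hpi.ne'] using this
  rw [hcos1, mul_one] at h1
  have := Real.exp_lt_exp.2 (hr hu0)
  rw [Real.exp_zero] at this
  linarith

/-- The loop based at `1` that is the graph of `exp ∘ h` in polar coordinates. -/
noncomputable def polarLoop {A : Set ℂ} (hx : (1 : ℂ) ∉ A) (h : ℝ → ℝ) (hc : Continuous h)
    (h0 : h 0 = 0) (h1 : h 1 = 0) (hA : ∀ t : I, polarPoint (h t) t ∉ A) :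
    Path (X := {z : ℂ // z ∉ A}) ⟨1, hx⟩ ⟨1, hx⟩ where
  toFun t := ⟨polarPoint (h t) t, hA t⟩
  continuous_toFun := by
    refine Continuous.subtype_mk ?_ _
    exact continuous_polarPoint.comp (by fun_prop : Continuous fun t : I => (h t, (t : ℝ)))
  source' := by simp [h0, polarPoint_zero_zero]
  target' := by
    have := polarPoint_add_one 0 0
    simp_all [polarPoint_zero_zero]

theorem polarLoop_apply {A : Set ℂ} (hx : (1 : ℂ) ∉ A) (h : ℝ → ℝ) (hc : Continuous h)
    (h0 : h 0 = 0) (h1 : h 1 = 0) (hA : ∀ t : I, polarPoint (h t) t ∉ A) (t : I) :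
    (polarLoop hx h hc h0 h1 hA t : ℂ) = polarPoint (h t) t := rfl

/-- Polar loops passing a puncture of the unit circle on different sides are not homotopic. -/
theorem polarLoop_not_homotopic {A : Set ℂ} (hx : (1 : ℂ) ∉ A) {g h : ℝ → ℝ}
    (gc : Continuous g) (g0 : g 0 = 0) (g1 : g 1 = 0) (gA : ∀ t : I, polarPoint (g t) t ∉ A)
    (hc : Continuous h) (h0 : h 0 = 0) (h1 : h 1 = 0) (hA : ∀ t : I, polarPoint (h t) t ∉ A)
    {a : ℝ} (ha0 : 0 < a) (ha1 : a < 1) (haA : polarPoint 0 a ∈ A) (hga : g a < 0)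
    (hha : 0 < h a) :
    ¬ (polarLoop hx g gc g0 g1 gA).Homotopic (polarLoop hx h hc h0 h1 hA) := by
  intro H
  have habs (t : I) : |(t : ℝ) - a| < 1 := by
    rw [abs_lt]; constructor <;> linarith [t.2.1, t.2.2]
  have hg (t : I) : 1 - polarPoint (g t) (t - a) ∈ Complex.slitPlane :=
    one_sub_polarPoint_mem_slitPlane (habs t) fun ht => by rwa [sub_eq_zero.1 ht]
  have hh (t : I) : 1 - polarPoint (-h t) (a - t) ∈ Complex.slitPlane :=
    one_sub_polarPoint_mem_slitPlane (by rw [abs_sub_comm]; exact habs t) fun ht => by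
      rw [← sub_eq_zero.1 ht]; linarith
  have hf0 (z : {z : ℂ // z ∉ A}) : 1 - (z : ℂ) * polarPoint 0 (-a) ≠ 0 := by
    intro hz
    apply z.2
    have : (z : ℂ) = polarPoint 0 a := by
      have h2 : polarPoint 0 (-a) * polarPoint 0 a = 1 := by
        rw [polarPoint_mul]; simp [polarPoint_zero_zero]
      linear_combination -(z : ℂ) * h2 - polarPoint 0 a * hz
    rwa [this]
  have key := log_increment_eq_of_homotopic H
    (f := fun z => 1 - (z : ℂ) * polarPoint 0 (-a)) (by fun_prop) hf0
    (L := fun t => Complex.log (1 - polarPoint (g t) (t - a)))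
    (M := fun t => h t + 2 * Real.pi * (t - a : ℝ) * Complex.I + Real.pi * Complex.I
      + Complex.log (1 - polarPoint (-h t) (a - t)))
    (Continuous.clog (continuous_const.sub (continuous_polarPoint.comp
      (by fun_prop : Continuous fun t : I => (g t, (t : ℝ) - a)))) hg)
    (Continuous.add (by fun_prop) (Continuous.clog (continuous_const.sub
      (continuous_polarPoint.comp
        (by fun_prop : Continuous fun t : I => (-h t, a - (t : ℝ))))) hh))
    (fun t => by
      rw [Complex.exp_log (Complex.slitPlane_ne_zero (hg t)), polarLoop_apply, polarPoint_mul]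
      simp [sub_eq_add_neg])
    (fun t => by
      rw [Complex.exp_add, Complex.exp_log (Complex.slitPlane_ne_zero (hh t)), polarLoop_apply,
        polarPoint_mul, Complex.exp_add, Complex.exp_pi_mul_I]
      change polarPoint (h t) (t - a) * -1 * _ = _
      have h3 : polarPoint (h t) (t - a) * polarPoint (-h t) (a - t) = 1 := by
        rw [polarPoint_mul]; simp [polarPoint_zero_zero]
      rw [add_zero, ← sub_eq_add_neg]
      linear_combination h3)
  have e1 : polarPoint 0 (1 - a) = polarPoint 0 (-a) := by
    rw [← polarPoint_add_one 0 (-a)]; ring_nf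
  have e2 : polarPoint 0 (a - 1) = polarPoint 0 a := by
    rw [← polarPoint_add_one 0 (a - 1)]; ring_nf
  simp [g0, g1, h0, h1, e1, e2] at key
  have h4 := congrArg Complex.im key
  simp at h4
  nlinarith [Real.pi_pos]

theorem polarLoop_avoidsBase {A : Set ℂ} (hx : (1 : ℂ) ∉ A) {h : ℝ → ℝ} (hc : Continuous h)
    (h0 : h 0 = 0) (h1 : h 1 = 0) (hA : ∀ t : I, polarPoint (h t) t ∉ A) :
    AvoidsBase (polarLoop hx h hc h0 h1 hA) := by
  intro t ht0 ht1 ht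
  rw [polarLoop_apply, ← polarPoint_zero_zero] at ht
  have ht2 : (t : ℝ) < 1 := unitInterval.lt_one_iff_ne_one.2 ht1
  have := (polarPoint_inj ht (by rw [sub_zero, abs_of_nonneg t.2.1]; exact ht2)).2
  exact ht0 (Subtype.ext this)

theorem polarLoop_selfIntersLt {A : Set ℂ} (hx : (1 : ℂ) ∉ A) {h : ℝ → ℝ} (hc : Continuous h)
    (h0 : h 0 = 0) (h1 : h 1 = 0) (hA : ∀ t : I, polarPoint (h t) t ∉ A) {k : ℕ} (hk : 0 < k) :
    SelfIntersLt (polarLoop hx h hc h0 h1 hA) k := by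
  have hempty : {p : I × I | p.1 ≠ 0 ∧ p.2 ≠ 1 ∧ p.1 < p.2 ∧
      polarLoop hx h hc h0 h1 hA p.1 = polarLoop hx h hc h0 h1 hA p.2} = ∅ := by
    rw [Set.eq_empty_iff_forall_notMem]
    rintro ⟨s, t⟩ ⟨-, ht1, hst, heq⟩
    have ht2 : (t : ℝ) < 1 := unitInterval.lt_one_iff_ne_one.2 ht1
    have hst' : (s : ℝ) < t := hst
    have := (polarPoint_inj (congrArg Subtype.val heq)
      (by rw [abs_lt]; constructor <;> linarith [s.2.1])).2
    exact hst'.ne this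
  rw [SelfIntersLt, hempty, Set.encard_empty]
  exact_mod_cast hk

/-- Polar loops cross only at common values of their radius functions. -/
theorem polarLoop_crossingsLt {A : Set ℂ} (hx : (1 : ℂ) ∉ A) {g h : ℝ → ℝ}
    (gc : Continuous g) (g0 : g 0 = 0) (g1 : g 1 = 0) (gA : ∀ t : I, polarPoint (g t) t ∉ A)
    (hc : Continuous h) (h0 : h 0 = 0) (h1 : h 1 = 0) (hA : ∀ t : I, polarPoint (h t) t ∉ A)
    {k : ℕ} (R : Finset ℝ) (hR : ∀ t, 0 < t → t < 1 → g t = h t → t ∈ R) (hk : R.card < k) :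
    CrossingsLt (polarLoop hx g gc g0 g1 gA) (polarLoop hx h hc h0 h1 hA) k := by
  have hdiag (p : I × I) (hp : p ∈ {p : I × I | p.1 ≠ 0 ∧ p.1 ≠ 1 ∧ p.2 ≠ 0 ∧ p.2 ≠ 1 ∧
      polarLoop hx g gc g0 g1 gA p.1 = polarLoop hx h hc h0 h1 hA p.2}) :
      p.1 = p.2 ∧ (p.1 : ℝ) ∈ R := by
    obtain ⟨s, t⟩ := p
    obtain ⟨hs0, hs1, ht0, ht1, heq⟩ := hp
    have ht2 : (t : ℝ) < 1 := unitInterval.lt_one_iff_ne_one.2 ht1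
    have ht3 : (0 : ℝ) < t := unitInterval.pos_iff_ne_zero.2 ht0
    have hs2 : (s : ℝ) < 1 := unitInterval.lt_one_iff_ne_one.2 hs1
    have hs3 : (0 : ℝ) < s := unitInterval.pos_iff_ne_zero.2 hs0
    obtain ⟨hr, hst⟩ := polarPoint_inj (congrArg Subtype.val heq)
      (by rw [abs_lt]; constructor <;> linarith)
    rw [← hst] at hr
    exact ⟨Subtype.ext hst, hR s hs3 hs2 hr⟩
  refine lt_of_le_of_lt (b := (R : Set ℝ).encard) ?_ ?_
  · refine Set.encard_le_encard_of_injOn (f := fun p : I × I => (p.1 : ℝ))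
      (fun p hp => (hdiag p hp).2) fun p hp q hq hpq => ?_
    have h3 : p.1 = q.1 := Subtype.ext hpq
    exact Prod.ext h3 ((hdiag p hp).1.symm.trans (h3.trans (hdiag q hq).1))
  · rw [Set.encard_coe_eq_coe_finsetCard]
    exact_mod_cast hk


/-- (`f(n,n) ≥ 2^n`.) For every `n ≥ 2` there are `2^n` pairwise
non-homotopic `x`-loops in the complement of `n` points, none passing through `x`,
each with fewer than `n` self-intersections, and every pair crossing fewer than
`n` times. -/
theorem loops_lower_bound_diag (n : ℕ) (hn : 2 ≤ n) :
    ∃ (A : Set ℂ) (_ : A.Finite) (_ : A.ncard = n) (x : ℂ) (hx : x ∉ A)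
      (γ : Fin (2 ^ n) → Path (X := {z : ℂ // z ∉ A}) ⟨x, hx⟩ ⟨x, hx⟩),
      (∀ i j, i ≠ j → ¬ (γ i).Homotopic (γ j)) ∧
      (∀ i, AvoidsBase (γ i)) ∧
      (∀ i, SelfIntersLt (γ i) n) ∧
      (∀ i j, i ≠ j → CrossingsLt (γ i) (γ j) n) := by
  let τ : Fin n → ℝ := fun i => ((i : ℝ) + 1) / (n + 1)
  have τ_pos (i) : 0 < τ i := by positivity
  have τ_lt (i) : τ i < 1 := by
    have : (i : ℝ) < n := by exact_mod_cast i.2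
    rw [div_lt_one (by positivity)]
    linarith
  have τ_inj : Function.Injective τ := fun i j hij => by
    have : ((i : ℝ) + 1) / (n + 1) = ((j : ℝ) + 1) / (n + 1) := hij
    rw [div_left_inj' (by positivity)] at this
    exact Fin.ext (by exact_mod_cast add_right_cancel this)
  have abs_lt_one {t : ℝ} (ht : t ∈ I) (i) : |t - τ i| < 1 := by
    rw [abs_lt]
    constructor <;> linarith [ht.1, ht.2, τ_pos i, τ_lt i]
  let a : Fin n → ℂ := fun i => polarPoint 0 (τ i)
  have a_inj : Function.Injective a := fun i j hij =>
    τ_inj (polarPoint_inj hij (abs_lt_one ⟨(τ_pos i).le, (τ_lt i).le⟩ j)).2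
  have hx : (1 : ℂ) ∉ Set.range a := by
    rintro ⟨i, hi⟩
    rw [← polarPoint_zero_zero] at hi
    have := (polarPoint_inj hi.symm (abs_lt_one ⟨le_rfl, zero_le_one⟩ i)).2
    exact (τ_pos i).ne this
  let e : Fin (2 ^ n) ≃ (Fin n → Bool) := Fintype.equivOfCardEq (by simp)
  let v : Fin (2 ^ n) → Fin n → ℝ := fun k i => if e k i then 1 else -1
  let P : Fin (2 ^ n) → Polynomial ℝ := fun k => Lagrange.interpolate Finset.univ τ (v k)
  have P_eval (k i) : (P k).eval (τ i) = v k i :=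
    Lagrange.eval_interpolate_at_node _ τ_inj.injOn (Finset.mem_univ i)
  have P_deg (k) : (P k).degree < n :=
    (Lagrange.degree_interpolate_lt (v k) (s := Finset.univ) τ_inj.injOn).trans_eq (by simp)
  let h : Fin (2 ^ n) → ℝ → ℝ := fun k t => t * (1 - t) * (P k).eval t
  have hc (k) : Continuous (h k) := by fun_prop
  have h0 (k) : h k 0 = 0 := by simp [h]
  have h1 (k) : h k 1 = 0 := by simp [h]
  have hτ (k i) : h k (τ i) = τ i * (1 - τ i) * v k i := by simp only [h, P_eval]
  have τ_weight_pos (i) : 0 < τ i * (1 - τ i) := mul_pos (τ_pos i) (sub_pos.2 (τ_lt i))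
  have hpos (k i) (hk : e k i = true) : 0 < h k (τ i) := by
    simpa [hτ, v, hk] using τ_weight_pos i
  have hneg (k i) (hk : e k i = false) : h k (τ i) < 0 := by
    simpa [hτ, v, hk] using τ_weight_pos i
  have hA (k) (t : I) : polarPoint (h k t) t ∉ Set.range a := by
    rintro ⟨i, hi⟩
    obtain ⟨h2, h3⟩ := polarPoint_inj hi.symm (abs_lt_one t.2 i)
    rw [h3] at h2
    cases hk : e k i
    · exact (hneg k i hk).ne h2
    · exact (hpos k i hk).ne' h2
  refine ⟨Set.range a, Set.finite_range a, ?_, 1, hx,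
    fun k => polarLoop hx (h k) (hc k) (h0 k) (h1 k) (hA k), ?_, ?_, ?_, ?_⟩
  · rw [← Set.image_univ, Set.ncard_image_of_injective _ a_inj, Set.ncard_univ, Nat.card_fin]
  · intro k l hkl H
    obtain ⟨i, hi⟩ := Function.ne_iff.1 (e.injective.ne hkl)
    cases hk : e k i
    · have hl : e l i = true := by simpa [hk] using hi.symm
      exact polarLoop_not_homotopic hx _ _ _ _ _ _ _ _ (τ_pos i) (τ_lt i) ⟨i, rfl⟩
        (hneg k i hk) (hpos l i hl) H
    · have hl : e l i = false := by simpa [hk] using hi.symm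
      exact polarLoop_not_homotopic hx _ _ _ _ _ _ _ _ (τ_pos i) (τ_lt i) ⟨i, rfl⟩
        (hneg l i hl) (hpos k i hk) H.symm
  · exact fun k => polarLoop_avoidsBase hx _ _ _ _
  · exact fun k => polarLoop_selfIntersLt hx _ _ _ _ (by lia)
  · intro k l hkl
    have hne : P k - P l ≠ 0 := by
      intro hP
      refine hkl (e.injective (funext fun i => ?_))
      have hv : v k i = v l i := by rw [← P_eval, ← P_eval, sub_eq_zero.1 hP]
      cases hk : e k i <;> cases hl : e l i <;> simp [v, hk, hl] at hv ⊢ <;> norm_num at hv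
    refine polarLoop_crossingsLt hx _ _ _ _ _ _ _ _ (P k - P l).roots.toFinset
      (fun t ht0 ht1 ht => ?_) ?_
    · rw [Multiset.mem_toFinset, Polynomial.mem_roots hne, Polynomial.IsRoot, Polynomial.eval_sub,
        sub_eq_zero]
      exact mul_left_cancel₀ (mul_pos ht0 (sub_pos.2 ht1)).ne' ht
    · have hdeg : (P k - P l).degree < n :=
        (Polynomial.degree_sub_le _ _).trans_lt (max_lt (P_deg k) (P_deg l))
      exact (Multiset.toFinset_card_le _).trans_lt ((Polynomial.card_roots' _).trans_lt
        ((Polynomial.natDegree_lt_iff_degree_lt hne).2 hdeg))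
end

section
/- Every loose non-homotopic drawing in the sphere with exactly 2 vertices has at most 1 edge. -/
open unitInterval

/-- A drawing in the sphere (`OnePoint ℂ`) with `n` vertices and `m` edges. -/
structure SphereDrawing (n m : ℕ) where
  V : Set (OnePoint ℂ)
  finV : V.Finite
  cardV : V.ncard = n
  f : Fin m → I → OnePoint ℂ
  cont : ∀ e, Continuous (f e)
  source_mem : ∀ e, f e 0 ∈ V
  target_mem : ∀ e, f e 1 ∈ V
  interior_not_mem : ∀ e, ∀ t : I, t ≠ 0 → t ≠ 1 → f e t ∉ V

/-- Homotopy between two curves on the sphere, fixing the endpoints of the first,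
with interior avoiding the vertex set `V`. -/
def SphereHomotopicIn (V : Set (OnePoint ℂ)) (a b : I → OnePoint ℂ) : Prop :=
  ∃ g : I × I → OnePoint ℂ, Continuous g ∧
    (∀ t, g (0, t) = a t) ∧ (∀ t, g (1, t) = b t) ∧
    (∀ s, g (s, 0) = a 0) ∧ (∀ s, g (s, 1) = a 1) ∧
    (∀ s t : I, s ≠ 0 → s ≠ 1 → t ≠ 0 → t ≠ 1 → g (s, t) ∉ V)

/-- Two edges are homotopic if one is homotopic to the other or to its reversal. -/
def SphereEdgeHomotopic (V : Set (OnePoint ℂ)) (a b : I → OnePoint ℂ) : Prop :=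
  SphereHomotopicIn V a b ∨ SphereHomotopicIn V (fun t => a (σ t)) b

/-- An edge is a trivial loop if it is homotopic to the constant map at its endpoint. -/
def SphereIsTrivialLoop (V : Set (OnePoint ℂ)) (a : I → OnePoint ℂ) : Prop :=
  SphereEdgeHomotopic V a fun _ => a 0

/-- A sphere drawing is non-homotopic if no two distinct edges are homotopic and
no edge is a trivial loop. -/
def SphereDrawing.NonHomotopic {n m : ℕ} (D : SphereDrawing n m) : Prop :=
  (∀ e e' : Fin m, e ≠ e' → ¬ SphereEdgeHomotopic D.V (D.f e) (D.f e')) ∧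
  (∀ e : Fin m, ¬ SphereIsTrivialLoop D.V (D.f e))

/-- A sphere drawing is loose if no two distinct edges cross. -/
def SphereDrawing.Loose {n m : ℕ} (D : SphereDrawing n m) : Prop :=
  ∀ e e' : Fin m, e ≠ e' → ∀ t t' : I, t ≠ 0 → t ≠ 1 → t' ≠ 0 → t' ≠ 1 →
    D.f e t ≠ D.f e' t'

open Set Filter Topology OnePoint

/-- The continuous extension of `z ↦ z⁻¹` to the sphere. -/
noncomputable def OnePoint.complexInv (x : OnePoint ℂ) : OnePoint ℂ :=
  x.elim ((0 : ℂ) : OnePoint ℂ) (Function.update (fun z : ℂ => ((z⁻¹ : ℂ) : OnePoint ℂ)) 0 ∞)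

lemma OnePoint.complexInv_infty : complexInv ∞ = ((0 : ℂ) : OnePoint ℂ) := rfl

lemma OnePoint.complexInv_zero : complexInv ((0 : ℂ) : OnePoint ℂ) = ∞ := by
  simp [complexInv]

lemma OnePoint.complexInv_coe {z : ℂ} (hz : z ≠ 0) :
    complexInv (z : OnePoint ℂ) = ((z⁻¹ : ℂ) : OnePoint ℂ) := by
  simp [complexInv, hz]

lemma OnePoint.complexInv_involutive : Function.Involutive complexInv := by
  intro x
  induction x using OnePoint.rec with
  | infty => rw [complexInv_infty, complexInv_zero]
  | coe z =>
    by_cases hz : z = 0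
    · rw [hz, complexInv_zero, complexInv_infty]
    · rw [complexInv_coe hz, complexInv_coe (inv_ne_zero hz), inv_inv]

lemma OnePoint.continuous_complexInv : Continuous complexInv := by
  rw [OnePoint.continuous_iff]
  constructor
  · rw [complexInv_infty, coclosedCompact_eq_cocompact, ← Metric.cobounded_eq_cocompact]
    refine Tendsto.congr' ?_
      ((continuous_coe.tendsto (0 : ℂ)).comp tendsto_inv₀_cobounded)
    filter_upwards [Bornology.eventually_ne_cobounded (0 : ℂ)] with z hz
    exact (complexInv_coe hz).symm
  · change Continuous (Function.update (fun z : ℂ => ((z⁻¹ : ℂ) : OnePoint ℂ)) 0 ∞)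
    rw [continuous_iff_continuousAt]
    intro z
    by_cases hz : z = 0
    · subst hz
      rw [continuousAt_update_same]
      have h := OnePoint.tendsto_coe_infty (X := ℂ)
      rw [coclosedCompact_eq_cocompact, ← Metric.cobounded_eq_cocompact] at h
      exact h.comp tendsto_inv₀_nhdsNE_zero
    · rw [continuousAt_update_of_ne hz]
      exact continuous_coe.continuousAt.comp (continuousAt_inv₀ hz)

/-- Inversion as a self-homeomorphism of the sphere. -/
noncomputable def OnePoint.complexInvHomeomorph : OnePoint ℂ ≃ₜ OnePoint ℂ where
  toEquiv := complexInv_involutive.toPerm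
  continuous_toFun := continuous_complexInv
  continuous_invFun := continuous_complexInv

lemma OnePoint.exists_homeomorph_zero_infty {v w : OnePoint ℂ} (hvw : v ≠ w) :
    ∃ h : OnePoint ℂ ≃ₜ OnePoint ℂ, h v = ((0 : ℂ) : OnePoint ℂ) ∧ h w = ∞ := by
  have fixing_infty {v : OnePoint ℂ} (hv : v ≠ ∞) :
      ∃ h : OnePoint ℂ ≃ₜ OnePoint ℂ, h v = ((0 : ℂ) : OnePoint ℂ) ∧ h ∞ = ∞ := by
    obtain ⟨c, rfl⟩ := OnePoint.ne_infty_iff_exists.mp hv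
    refine ⟨(Homeomorph.subRight c).onePointCongr, ?_, rfl⟩
    change (((c - c : ℂ)) : OnePoint ℂ) = _
    rw [sub_self]
  have to_infty : ∃ h : OnePoint ℂ ≃ₜ OnePoint ℂ, h w = ∞ := by
    induction w using OnePoint.rec with
    | infty => exact ⟨Homeomorph.refl _, rfl⟩
    | coe c =>
      obtain ⟨h, hc, -⟩ := fixing_infty (OnePoint.coe_ne_infty c)
      refine ⟨h.trans complexInvHomeomorph, ?_⟩
      rw [Homeomorph.trans_apply, hc]
      exact complexInv_zero
  obtain ⟨k, hk⟩ := to_infty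
  obtain ⟨l, hl, hl'⟩ := fixing_infty (v := k v) (hk ▸ k.injective.ne hvw)
  exact ⟨k.trans l, hl, by rw [Homeomorph.trans_apply, hk, hl']⟩

lemma SphereHomotopicIn.of_homeomorph (h : OnePoint ℂ ≃ₜ OnePoint ℂ) {V : Set (OnePoint ℂ)}
    {a b : I → OnePoint ℂ} (hab : SphereHomotopicIn (h '' V) (h ∘ a) (h ∘ b)) :
    SphereHomotopicIn V a b := by
  obtain ⟨g, hg, h0, h1, hs, ht, hV⟩ := hab
  refine ⟨h.symm ∘ g, h.symm.continuous.comp hg, fun t => ?_, fun t => ?_, fun s => ?_,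
    fun s => ?_, fun s t hs0 hs1 ht0 ht1 hmem => hV s t hs0 hs1 ht0 ht1 ⟨_, hmem, ?_⟩⟩ <;>
  simp [*]

/-- The extended norm on the sphere. -/
noncomputable def OnePoint.complexENorm (x : OnePoint ℂ) : ENNReal :=
  x.elim ⊤ (fun z => ‖z‖ₑ)

lemma OnePoint.continuous_complexENorm : Continuous complexENorm := by
  rw [OnePoint.continuous_iff]
  refine ⟨?_, continuous_enorm⟩
  rw [coclosedCompact_eq_cocompact]
  refine (ENNReal.tendsto_ofReal_atTop.comp (tendsto_norm_cocompact_atTop (E := ℂ))).congr ?_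
  exact fun z => ofReal_norm z

lemma OnePoint.tendsto_of_complexENorm_zero {α : Type*} {l : Filter α} {f : α → OnePoint ℂ}
    (hf : Tendsto (fun a => complexENorm (f a)) l (𝓝 0)) :
    Tendsto f l (𝓝 ((0 : ℂ) : OnePoint ℂ)) := by
  have hpre : complexENorm ⁻¹' {0} = {((0 : ℂ) : OnePoint ℂ)} := by
    ext x
    induction x using OnePoint.rec <;> simp [complexENorm]
  have h := continuous_complexENorm.isClosedMap.comap_nhds_eq continuous_complexENorm 0
  rw [hpre, nhdsSet_singleton] at h
  rw [← h]
  exact tendsto_comap_iff.mpr hf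

lemma OnePoint.tendsto_of_complexENorm_top {α : Type*} {l : Filter α} {f : α → OnePoint ℂ}
    (hf : Tendsto (fun a => complexENorm (f a)) l (𝓝 ⊤)) :
    Tendsto f l (𝓝 ∞) := by
  have hpre : complexENorm ⁻¹' {⊤} = {(∞ : OnePoint ℂ)} := by
    ext x
    induction x using OnePoint.rec <;> simp [complexENorm]
  have h := continuous_complexENorm.isClosedMap.comap_nhds_eq continuous_complexENorm ⊤
  rw [hpre, nhdsSet_singleton] at h
  rw [← h]
  exact tendsto_comap_iff.mpr hf

lemma exists_continuous_of_forall_ne_infty {X : Type*} [TopologicalSpace X] {a : X → OnePoint ℂ}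
    (ha : Continuous a) (hne : ∀ t, a t ≠ ∞) :
    ∃ b : X → ℂ, Continuous b ∧ ∀ t, a t = (b t : OnePoint ℂ) := by
  choose b hb using fun t => OnePoint.ne_infty_iff_exists.mp (hne t)
  refine ⟨b, ?_, fun t => (hb t).symm⟩
  rw [OnePoint.isOpenEmbedding_coe.isInducing.continuous_iff]
  exact ha.congr fun t => (hb t).symm

lemma sphereHomotopicIn_const_of_loop {a : I → OnePoint ℂ} (ha : Continuous a)
    (h0 : a 0 = ((0 : ℂ) : OnePoint ℂ)) (h1 : a 1 = ((0 : ℂ) : OnePoint ℂ))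
    (hV : ∀ t : I, t ≠ 0 → t ≠ 1 → a t ∉ ({((0 : ℂ) : OnePoint ℂ), ∞} : Set (OnePoint ℂ))) :
    SphereHomotopicIn {((0 : ℂ) : OnePoint ℂ), ∞} a fun _ => a 0 := by
  have hne : ∀ t, a t ≠ ∞ := by
    intro t
    by_cases ht0 : t = 0
    · simp [ht0, h0]
    by_cases ht1 : t = 1
    · simp [ht1, h1]
    · exact fun h => hV t ht0 ht1 (by simp [h])
  obtain ⟨b, hb, hab⟩ := exists_continuous_of_forall_ne_infty ha hne
  have hb0 : b 0 = 0 := by simpa [hab] using h0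
  have hb1 : b 1 = 0 := by simpa [hab] using h1
  refine ⟨fun p => (((1 - ((p.1 : ℝ) : ℂ)) * b p.2 : ℂ) : OnePoint ℂ),
    continuous_coe.comp (by fun_prop), fun t => by simp [hab], fun t => by simp [h0],
    fun s => by simp [hb0, h0], fun s => by simp [hb1, h1], fun s t _ hs1 ht0 ht1 => ?_⟩
  have hbt : b t ≠ 0 := fun h => hV t ht0 ht1 (by simp [hab, h])
  have hs : 1 - ((s : ℝ) : ℂ) ≠ 0 := by
    rw [sub_ne_zero]
    exact_mod_cast fun h : (1 : ℝ) = s => hs1 (Subtype.ext h.symm)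
  simp [hbt, hs]

lemma exists_continuousOn_log {a : I → OnePoint ℂ} (ha : Continuous a)
    (hV : ∀ t : I, t ≠ 0 → t ≠ 1 → a t ∉ ({((0 : ℂ) : OnePoint ℂ), ∞} : Set (OnePoint ℂ))) :
    ∃ F : I → ℂ, ContinuousOn F {t | t ≠ 0 ∧ t ≠ 1} ∧
      ∀ t : I, t ≠ 0 → t ≠ 1 → a t = (Complex.exp (F t) : OnePoint ℂ) := by
  have ne_zero (x : Ioo (0 : ℝ) 1) : (⟨x, x.2.1.le, x.2.2.le⟩ : I) ≠ 0 :=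
    fun h => x.2.1.ne' congr(($h : ℝ))
  have ne_one (x : Ioo (0 : ℝ) 1) : (⟨x, x.2.1.le, x.2.2.le⟩ : I) ≠ 1 :=
    fun h => x.2.2.ne congr(($h : ℝ))
  let ι : Ioo (0 : ℝ) 1 → I := fun x => ⟨x, x.2.1.le, x.2.2.le⟩
  have hι : Continuous ι := by fun_prop
  obtain ⟨b, hb, hab⟩ := exists_continuous_of_forall_ne_infty (ha.comp hι)
    fun x h => hV _ (ne_zero x) (ne_one x) (by simpa using Or.inr h)
  have hb0 (x) : b x ≠ 0 :=
    fun h => hV _ (ne_zero x) (ne_one x) (Or.inl ((hab x).trans (by rw [h])))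
  have : ContractibleSpace (Ioo (0 : ℝ) 1) :=
    (convex_Ioo 0 1).contractibleSpace ⟨1 / 2, by norm_num, by norm_num⟩
  have : LocallyPathConnectedSpace (Ioo (0 : ℝ) 1) := isOpen_Ioo.locallyPathConnectedSpace
  let x₀ : Ioo (0 : ℝ) 1 := ⟨1 / 2, by norm_num, by norm_num⟩
  obtain ⟨F, ⟨-, hF⟩, -⟩ := Complex.isCoveringMapOn_exp.existsUnique_continuousMap_lifts
    ⟨b, hb⟩ (a₀ := x₀) (Complex.exp_log (hb0 x₀)) hb0
  have mem_Ioo {t : I} (ht : t ≠ 0 ∧ t ≠ 1) : (t : ℝ) ∈ Ioo (0 : ℝ) 1 :=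
    ⟨unitInterval.pos_iff_ne_zero.mpr ht.1, unitInterval.lt_one_iff_ne_one.mpr ht.2⟩
  classical
  refine ⟨fun t => if ht : t ≠ 0 ∧ t ≠ 1 then F ⟨t, mem_Ioo ht⟩ else 0, ?_, fun t ht0 ht1 => ?_⟩
  · rw [continuousOn_iff_continuous_domRestrict]
    have : Continuous fun t : {t : I | t ≠ 0 ∧ t ≠ 1} => F ⟨t, mem_Ioo t.2⟩ := by fun_prop
    refine this.congr fun t => ?_
    rw [domRestrict_apply, dif_pos (show t.1 ≠ 0 ∧ t.1 ≠ 1 from t.2)]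
  · beta_reduce
    rw [dif_pos (show t ≠ 0 ∧ t ≠ 1 from ⟨ht0, ht1⟩)]
    have := congrFun hF ⟨t, mem_Ioo ⟨ht0, ht1⟩⟩
    simp only [Function.comp_apply, ContinuousMap.coe_mk] at this
    rw [this]
    exact hab ⟨t, mem_Ioo ⟨ht0, ht1⟩⟩

lemma enorm_exp_segment_mem_Icc (z w : ℂ) (s : I) :
    ‖Complex.exp ((1 - ((s : ℝ) : ℂ)) * z + ((s : ℝ) : ℂ) * w)‖ₑ ∈
      Icc (min ‖Complex.exp z‖ₑ ‖Complex.exp w‖ₑ) (max ‖Complex.exp z‖ₑ ‖Complex.exp w‖ₑ) := by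
  have hs0 : (0 : ℝ) ≤ s := s.2.1
  have hs1 : (s : ℝ) ≤ 1 := s.2.2
  simp only [← ofReal_norm, Complex.norm_exp]
  have hre : ((1 - ((s : ℝ) : ℂ)) * z + ((s : ℝ) : ℂ) * w).re
      = (1 - (s : ℝ)) * z.re + (s : ℝ) * w.re := by simp
  rw [hre, mem_Icc, min_le_iff, le_max_iff]
  rcases le_total z.re w.re with h | h
  · exact ⟨Or.inl (ENNReal.ofReal_le_ofReal (Real.exp_le_exp.mpr (by nlinarith))),
      Or.inr (ENNReal.ofReal_le_ofReal (Real.exp_le_exp.mpr (by nlinarith)))⟩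
  · exact ⟨Or.inr (ENNReal.ofReal_le_ofReal (Real.exp_le_exp.mpr (by nlinarith))),
      Or.inl (ENNReal.ofReal_le_ofReal (Real.exp_le_exp.mpr (by nlinarith)))⟩

lemma sphereHomotopicIn_of_arcs {a b : I → OnePoint ℂ} (ha : Continuous a) (hb : Continuous b)
    (ha0 : a 0 = ((0 : ℂ) : OnePoint ℂ)) (ha1 : a 1 = ∞)
    (hb0 : b 0 = ((0 : ℂ) : OnePoint ℂ)) (hb1 : b 1 = ∞)
    (haV : ∀ t : I, t ≠ 0 → t ≠ 1 → a t ∉ ({((0 : ℂ) : OnePoint ℂ), ∞} : Set (OnePoint ℂ)))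
    (hbV : ∀ t : I, t ≠ 0 → t ≠ 1 → b t ∉ ({((0 : ℂ) : OnePoint ℂ), ∞} : Set (OnePoint ℂ))) :
    SphereHomotopicIn {((0 : ℂ) : OnePoint ℂ), ∞} a b := by
  obtain ⟨F, hF, haF⟩ := exists_continuousOn_log ha haV
  obtain ⟨G, hG, hbG⟩ := exists_continuousOn_log hb hbV
  classical
  let k : I × I → ℂ := fun p =>
    Complex.exp ((1 - ((p.1 : ℝ) : ℂ)) * F p.2 + ((p.1 : ℝ) : ℂ) * G p.2)
  let g : I × I → OnePoint ℂ := fun p => if p.2 ≠ 0 ∧ p.2 ≠ 1 then (k p : OnePoint ℂ) else a p.2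
  have hg (s t : I) (ht : t ≠ 0 ∧ t ≠ 1) : g (s, t) = (k (s, t) : OnePoint ℂ) := if_pos ht
  have hg0 (s : I) : g (s, 0) = a 0 := if_neg (by simp)
  have hg1 (s : I) : g (s, 1) = a 1 := if_neg (by simp)
  have norm_mem (p : I × I) : complexENorm (g p) ∈
      Icc (min (complexENorm (a p.2)) (complexENorm (b p.2)))
        (max (complexENorm (a p.2)) (complexENorm (b p.2))) := by
    obtain ⟨s, t⟩ := p
    by_cases ht0 : t = 0
    · subst ht0
      simp [hg0, ha0, hb0]
    by_cases ht1 : t = 1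
    · subst ht1
      simp [hg1, ha1, hb1]
    · rw [hg s t ⟨ht0, ht1⟩, haF t ht0 ht1, hbG t ht0 ht1]
      exact enorm_exp_segment_mem_Icc (F t) (G t) s
  have tendsto_norm (s t : I) (h : b t = a t) :
      Tendsto (fun p => complexENorm (g p)) (𝓝 (s, t)) (𝓝 (complexENorm (a t))) := by
    have hna : Continuous fun p : I × I => complexENorm (a p.2) :=
      continuous_complexENorm.comp (ha.comp continuous_snd)
    have hnb : Continuous fun p : I × I => complexENorm (b p.2) :=
      continuous_complexENorm.comp (hb.comp continuous_snd)
    refine tendsto_of_tendsto_of_tendsto_of_le_of_le ?_ ?_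
      (fun p => (norm_mem p).1) (fun p => (norm_mem p).2)
    · simpa [h] using (hna.min hnb).tendsto (s, t)
    · simpa [h] using (hna.max hnb).tendsto (s, t)
  have gcont : Continuous g := by
    rw [continuous_iff_continuousAt]
    rintro ⟨s, t⟩
    by_cases ht0 : t = 0
    · subst ht0
      have h := tendsto_norm s 0 (hb0.trans ha0.symm)
      rw [ContinuousAt, hg0, ha0]
      exact tendsto_of_complexENorm_zero (by simpa [ha0, complexENorm] using h)
    by_cases ht1 : t = 1
    · subst ht1
      have h := tendsto_norm s 1 (hb1.trans ha1.symm)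
      rw [ContinuousAt, hg1, ha1]
      exact tendsto_of_complexENorm_top (by simpa [ha1, complexENorm] using h)
    have hopen : IsOpen {t : I | t ≠ 0 ∧ t ≠ 1} := isOpen_ne.inter isOpen_ne
    have hnhds : {t : I | t ≠ 0 ∧ t ≠ 1} ∈ 𝓝 t := hopen.mem_nhds ⟨ht0, ht1⟩
    have hFt : ContinuousAt (fun p : I × I => F p.2) (s, t) :=
      (hF.continuousAt hnhds).comp (f := Prod.snd) continuousAt_snd
    have hGt : ContinuousAt (fun p : I × I => G p.2) (s, t) :=
      (hG.continuousAt hnhds).comp (f := Prod.snd) continuousAt_snd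
    have hs : Continuous fun p : I × I => ((p.1 : ℝ) : ℂ) := by fun_prop
    have hk : ContinuousAt k (s, t) :=
      (((continuousAt_const.sub hs.continuousAt).mul hFt).add (hs.continuousAt.mul hGt)).cexp
    refine (continuous_coe.continuousAt.comp hk).congr ?_
    filter_upwards [continuousAt_snd.preimage_mem_nhds hnhds] with p hp
    exact (hg p.1 p.2 hp).symm
  refine ⟨g, gcont, fun t => ?_, fun t => ?_, hg0, hg1, fun s t _ _ ht0 ht1 => ?_⟩
  · by_cases ht : t ≠ 0 ∧ t ≠ 1
    · simp [hg _ _ ht, k, haF t ht.1 ht.2]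
    · exact if_neg ht
  · by_cases ht0 : t = 0
    · rw [ht0, hg0, ha0, hb0]
    by_cases ht1 : t = 1
    · rw [ht1, hg1, ha1, hb1]
    · simp [hg _ _ ⟨ht0, ht1⟩, k, hbG t ht0 ht1]
  · simp [hg _ _ ⟨ht0, ht1⟩, k, Complex.exp_ne_zero]

lemma sphereIsTrivialLoop_of_eq {v w : OnePoint ℂ} (hvw : v ≠ w) {a : I → OnePoint ℂ}
    (ha : Continuous a) (h0 : a 0 = v) (h1 : a 1 = v)
    (hV : ∀ t : I, t ≠ 0 → t ≠ 1 → a t ∉ ({v, w} : Set (OnePoint ℂ))) :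
    SphereIsTrivialLoop {v, w} a := by
  obtain ⟨h, hv, hw⟩ := OnePoint.exists_homeomorph_zero_infty hvw
  refine Or.inl (SphereHomotopicIn.of_homeomorph h ?_)
  rw [image_pair, hv, hw]
  refine sphereHomotopicIn_const_of_loop (h.continuous.comp ha) (by simp [h0, hv])
    (by simp [h1, hv]) fun t ht0 ht1 => ?_
  rw [← hv, ← hw, ← image_pair, Function.comp_apply, h.injective.mem_set_image]
  exact hV t ht0 ht1

lemma sphereHomotopicIn_of_eq_endpoints {v w : OnePoint ℂ} (hvw : v ≠ w) {a b : I → OnePoint ℂ}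
    (ha : Continuous a) (hb : Continuous b)
    (ha0 : a 0 = v) (ha1 : a 1 = w) (hb0 : b 0 = v) (hb1 : b 1 = w)
    (haV : ∀ t : I, t ≠ 0 → t ≠ 1 → a t ∉ ({v, w} : Set (OnePoint ℂ)))
    (hbV : ∀ t : I, t ≠ 0 → t ≠ 1 → b t ∉ ({v, w} : Set (OnePoint ℂ))) :
    SphereHomotopicIn {v, w} a b := by
  obtain ⟨h, hv, hw⟩ := OnePoint.exists_homeomorph_zero_infty hvw
  have avoids {c : I → OnePoint ℂ}
      (hc : ∀ t : I, t ≠ 0 → t ≠ 1 → c t ∉ ({v, w} : Set (OnePoint ℂ))) :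
      ∀ t : I, t ≠ 0 → t ≠ 1 →
        (h ∘ c) t ∉ ({((0 : ℂ) : OnePoint ℂ), ∞} : Set (OnePoint ℂ)) := by
    intro t ht0 ht1
    rw [← hv, ← hw, ← image_pair, Function.comp_apply, h.injective.mem_set_image]
    exact hc t ht0 ht1
  refine SphereHomotopicIn.of_homeomorph h ?_
  rw [image_pair, hv, hw]
  exact sphereHomotopicIn_of_arcs (h.continuous.comp ha) (h.continuous.comp hb)
    (by simp [ha0, hv]) (by simp [ha1, hw]) (by simp [hb0, hv]) (by simp [hb1, hw])
    (avoids haV) (avoids hbV)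

/-- On the sphere with two punctures, non-loop edges are homotopic up to reversal. -/
lemma sphereEdgeHomotopic_of_ne_endpoints {v w : OnePoint ℂ} (hvw : v ≠ w)
    {a b : I → OnePoint ℂ} (ha : Continuous a) (hb : Continuous b)
    (ha0 : a 0 ∈ ({v, w} : Set (OnePoint ℂ))) (ha1 : a 1 ∈ ({v, w} : Set (OnePoint ℂ)))
    (hb0 : b 0 ∈ ({v, w} : Set (OnePoint ℂ))) (hb1 : b 1 ∈ ({v, w} : Set (OnePoint ℂ)))
    (hane : a 0 ≠ a 1) (hbne : b 0 ≠ b 1)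
    (haV : ∀ t : I, t ≠ 0 → t ≠ 1 → a t ∉ ({v, w} : Set (OnePoint ℂ)))
    (hbV : ∀ t : I, t ≠ 0 → t ≠ 1 → b t ∉ ({v, w} : Set (OnePoint ℂ))) :
    SphereEdgeHomotopic {v, w} a b := by
  have haV' : ∀ t : I, t ≠ 0 → t ≠ 1 → a (σ t) ∉ ({v, w} : Set (OnePoint ℂ)) :=
    fun t ht0 ht1 => haV (σ t) (by simpa using ht1) (by simpa using ht0)
  have ha' : Continuous fun t => a (σ t) := ha.comp unitInterval.continuous_symm
  rcases ha0 with ha0 | ha0 <;> rcases ha1 with ha1 | ha1 <;>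
    rcases hb0 with hb0 | hb0 <;> rcases hb1 with hb1 | hb1 <;>
    first
    | exact absurd (ha0.trans ha1.symm) hane
    | exact absurd (hb0.trans hb1.symm) hbne
    | exact Or.inl (sphereHomotopicIn_of_eq_endpoints hvw ha hb ha0 ha1 hb0 hb1 haV hbV)
    | exact Or.inr (sphereHomotopicIn_of_eq_endpoints hvw ha' hb (by simpa using ha1)
        (by simpa using ha0) hb0 hb1 haV' hbV)
    | (rw [pair_comm] at haV haV' hbV ⊢
       first
       | exact Or.inl (sphereHomotopicIn_of_eq_endpoints hvw.symm ha hb ha0 ha1 hb0 hb1 haV hbV)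
       | exact Or.inr (sphereHomotopicIn_of_eq_endpoints hvw.symm ha' hb (by simpa using ha1)
          (by simpa using ha0) hb0 hb1 haV' hbV))

/-- Every loose non-homotopic drawing in the sphere with exactly `2`
vertices has at most `1` edge. -/
theorem loose_sphere_two_vertices (m : ℕ)
    (D : SphereDrawing 2 m) (hloose : D.Loose) (hD : D.NonHomotopic) :
    m ≤ 1 := by
  obtain ⟨v, w, hvw, hV⟩ := Set.ncard_eq_two.mp D.cardV
  have source := hV ▸ D.source_mem
  have target := hV ▸ D.target_mem
  have interior := hV ▸ D.interior_not_mem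
  obtain ⟨hne, hloop⟩ := hD
  rw [hV] at hne hloop
  have endpoints_ne (e : Fin m) : D.f e 0 ≠ D.f e 1 := by
    intro h
    rcases source e with h0 | h0
    · exact hloop e (sphereIsTrivialLoop_of_eq hvw (D.cont e) h0 (h ▸ h0) (interior e))
    · refine hloop e ?_
      rw [pair_comm]
      exact sphereIsTrivialLoop_of_eq hvw.symm (D.cont e) h0 (h ▸ h0)
        (pair_comm v w ▸ interior e)
  by_contra! hm
  let e : Fin m := ⟨0, by omega⟩
  let e' : Fin m := ⟨1, hm⟩
  exact hne e e' (by simp [e, e']) (sphereEdgeHomotopic_of_ne_endpoints hvw (D.cont e) (D.cont e')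
    (source e) (target e) (source e') (target e') (endpoints_ne e) (endpoints_ne e')
    (interior e) (interior e'))
end

section
/- For every n ≥ 1 there exists a loose non-homotopic drawing in the plane with n vertices and exactly 3n − 3 edges. -/
open unitInterval ENNReal

/-- A drawing in the plane with `n` vertices and `m` edges: a finite set `V ⊆ ℂ` of
`n` vertices together with continuous curves `f e : [0,1] → ℂ` whose endpoints are
vertices and whose interiors avoid the vertices. -/
structure PlaneDrawing (n m : ℕ) where
  V : Set ℂ
  finV : V.Finite
  cardV : V.ncard = n
  f : Fin m → I → ℂ
  cont : ∀ e, Continuous (f e)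
  source_mem : ∀ e, f e 0 ∈ V
  target_mem : ∀ e, f e 1 ∈ V
  interior_not_mem : ∀ e, ∀ t : I, t ≠ 0 → t ≠ 1 → f e t ∉ V

/-- Homotopy between two curves, fixing the endpoints of the first, with interior
avoiding the vertex set `V`. -/
def HomotopicIn (V : Set ℂ) (a b : I → ℂ) : Prop :=
  ∃ g : I × I → ℂ, Continuous g ∧
    (∀ t, g (0, t) = a t) ∧ (∀ t, g (1, t) = b t) ∧
    (∀ s, g (s, 0) = a 0) ∧ (∀ s, g (s, 1) = a 1) ∧
    (∀ s t : I, s ≠ 0 → s ≠ 1 → t ≠ 0 → t ≠ 1 → g (s, t) ∉ V)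

/-- Two edges are homotopic if one is homotopic to the other or to its reversal. -/
def EdgeHomotopic (V : Set ℂ) (a b : I → ℂ) : Prop :=
  HomotopicIn V a b ∨ HomotopicIn V (fun t => a (σ t)) b

/-- An edge is a trivial loop if it is homotopic to the constant map at its endpoint. -/
def IsTrivialLoop (V : Set ℂ) (a : I → ℂ) : Prop :=
  EdgeHomotopic V a fun _ => a 0

/-- A drawing is non-homotopic if no two distinct edges are homotopic and
no edge is a trivial loop. -/
def PlaneDrawing.NonHomotopic {n m : ℕ} (D : PlaneDrawing n m) : Prop :=
  (∀ e e' : Fin m, e ≠ e' → ¬ EdgeHomotopic D.V (D.f e) (D.f e')) ∧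
  (∀ e : Fin m, ¬ IsTrivialLoop D.V (D.f e))

/-- The crossing number: half the cardinality of the set of ordered crossings. -/
noncomputable def PlaneDrawing.crossingNumber {n m : ℕ} (D : PlaneDrawing n m) : ℝ≥0∞ :=
  (({p : (Fin m × I) × (Fin m × I) |
      p.1 ≠ p.2 ∧ p.1.2 ≠ 0 ∧ p.1.2 ≠ 1 ∧ p.2.2 ≠ 0 ∧ p.2.2 ≠ 1 ∧
      D.f p.1.1 p.1.2 = D.f p.2.1 p.2.2}).encard : ℝ≥0∞) / 2

/-- A plane drawing is loose if no two distinct edges cross. -/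
def PlaneDrawing.Loose {n m : ℕ} (D : PlaneDrawing n m) : Prop :=
  ∀ e e' : Fin m, e ≠ e' → ∀ t t' : I, t ≠ 0 → t ≠ 1 → t' ≠ 0 → t' ≠ 1 →
    D.f e t ≠ D.f e' t'

/-- The curve `a` has a continuous logarithm about `w` whose total change is `c`. -/
def HasLogChange (a : I → ℂ) (w c : ℂ) : Prop :=
  ∃ A : I → ℂ, Continuous A ∧ (∀ t, Complex.exp (A t) = a t - w) ∧ A 1 - A 0 = c

theorem HasLogChange.reverse {a : I → ℂ} {w c : ℂ} (h : HasLogChange a w c) :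
    HasLogChange (fun t => a (σ t)) w (-c) := by
  obtain ⟨A, hA, hexp, rfl⟩ := h
  exact ⟨fun t => A (σ t), by fun_prop, fun t => hexp _, by simp⟩

theorem HomotopicIn.endpoints {V : Set ℂ} {a b : I → ℂ} (h : HomotopicIn V a b) :
    a 0 = b 0 ∧ a 1 = b 1 := by
  obtain ⟨g, -, -, h1, h2, h3, -⟩ := h
  exact ⟨(h2 1).symm.trans (h1 0), (h3 1).symm.trans (h1 1)⟩

theorem HomotopicIn.logChange_eq {V : Set ℂ} {a b : I → ℂ} (h : HomotopicIn V a b) {w c c' : ℂ}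
    (hw : w ∈ V) (ha : HasLogChange a w c) (hb : HasLogChange b w c') : c = c' := by
  have hends := h.endpoints
  obtain ⟨g, hg, g0, g1, gs, gt, gV⟩ := h
  obtain ⟨A, hA, hAe, rfl⟩ := ha
  obtain ⟨B, hB, hBe, rfl⟩ := hb
  have hne : ∀ p : I × I, g p - w ≠ 0 := by
    rintro ⟨s, t⟩
    by_cases hs0 : s = 0
    · rw [hs0, g0, ← hAe]; exact Complex.exp_ne_zero _
    by_cases hs1 : s = 1
    · rw [hs1, g1, ← hBe]; exact Complex.exp_ne_zero _
    by_cases ht0 : t = 0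
    · rw [ht0, gs, ← hAe]; exact Complex.exp_ne_zero _
    by_cases ht1 : t = 1
    · rw [ht1, gt, ← hAe]; exact Complex.exp_ne_zero _
    intro h
    exact gV s t hs0 hs1 ht0 ht1 (by rwa [sub_eq_zero.1 h])
  have hBe' : ∀ t, Complex.exp (B t + (A 0 - B 0)) = b t - w := by
    intro t
    rw [Complex.exp_add, Complex.exp_sub, hBe, hAe, hBe, hends.1, div_self, mul_one]
    rw [← hBe]; exact Complex.exp_ne_zero _
  let A' : C(I, ℂ) := ⟨A, hA⟩
  let B' : C(I, ℂ) := ⟨fun t => B t + (A 0 - B 0), by fun_prop⟩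
  have key : A'.HomotopicRel B' {0, 1} := by
    rw [Complex.isCoveringMap_exp.homotopicRel_iff_comp ⟨0, by simp, by simp [A', B']⟩]
    refine ⟨⟨⟨⟨fun p => ⟨g p - w, hne p⟩, by fun_prop⟩, ?_, ?_⟩, ?_⟩⟩
    · intro t; simp [A', g0, hAe]
    · intro t; simp [B', g1, hBe']
    · rintro s t (rfl | rfl) <;> simp [A', gs, gt, hAe]
  have := key.some.fst_eq_snd (x := 1) (by simp)
  simp only [A', B', ContinuousMap.coe_mk] at this
  rw [this]; ring

theorem EdgeHomotopic.endpoints {V : Set ℂ} {a b : I → ℂ} (h : EdgeHomotopic V a b) :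
    (a 0 = b 0 ∧ a 1 = b 1) ∨ (a 1 = b 0 ∧ a 0 = b 1) := by
  rcases h with h | h
  · exact .inl h.endpoints
  · exact .inr (by simpa using h.endpoints)

theorem EdgeHomotopic.logChange_eq_or {V : Set ℂ} {a b : I → ℂ} (h : EdgeHomotopic V a b)
    {w c c' : ℂ} (hw : w ∈ V) (ha : HasLogChange a w c) (hb : HasLogChange b w c') :
    c = c' ∨ -c = c' := by
  rcases h with h | h
  · exact .inl (h.logChange_eq hw ha hb)
  · exact .inr (h.logChange_eq hw ha.reverse hb)

theorem hasLogChange_const {z w : ℂ} (h : z ≠ w) : HasLogChange (fun _ => z) w 0 :=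
  ⟨fun _ => Complex.log (z - w), by fun_prop,
    fun _ => Complex.exp_log (sub_ne_zero.2 h), by simp⟩

/-- The curve through angle `ω` along the circle with diameter `[0, d]`, starting at `0`. -/
noncomputable def circleCurve (d ω : ℝ) (t : I) : ℂ :=
  (d / 2 : ℝ) * (1 - Complex.exp ((ω * t : ℝ) * Complex.I))

theorem continuous_circleCurve (d ω : ℝ) : Continuous (circleCurve d ω) := by
  unfold circleCurve; fun_prop

theorem circleCurve_re (d ω : ℝ) (t : I) :
    (circleCurve d ω t).re = d / 2 * (1 - Real.cos (ω * t)) := by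
  rw [circleCurve, Complex.re_ofReal_mul, Complex.sub_re, Complex.exp_ofReal_mul_I_re,
    Complex.one_re]

theorem circleCurve_im (d ω : ℝ) (t : I) :
    (circleCurve d ω t).im = -(d / 2 * Real.sin (ω * t)) := by
  rw [circleCurve, Complex.im_ofReal_mul, Complex.sub_im, Complex.exp_ofReal_mul_I_im,
    Complex.one_im]
  ring

theorem circleCurve_sq (d ω : ℝ) (t : I) :
    (circleCurve d ω t).re ^ 2 + (circleCurve d ω t).im ^ 2 = d * (circleCurve d ω t).re := by
  rw [circleCurve_re, circleCurve_im]
  linear_combination d ^ 2 / 4 * Real.sin_sq_add_cos_sq (ω * t)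

theorem circleCurve_re_pos {d ω : ℝ} (hd : 0 < d) (hω : ω ≠ 0) (hω' : |ω| ≤ 2 * Real.pi) {t : I}
    (h0 : t ≠ 0) (h1 : t ≠ 1) : 0 < (circleCurve d ω t).re := by
  have ht0 : (0 : ℝ) < t := unitInterval.pos_iff_ne_zero.2 h0
  have ht1 : (t : ℝ) < 1 := unitInterval.lt_one_iff_ne_one.2 h1
  have habs : |ω * t| < 2 * Real.pi := by
    rw [abs_mul, abs_of_pos ht0]
    nlinarith [abs_pos.2 hω]
  rw [abs_lt] at habs
  have hne : Real.cos (ω * t) ≠ 1 := by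
    rw [Ne, Real.cos_eq_one_iff_of_lt_of_lt habs.1 habs.2]
    exact mul_ne_zero hω ht0.ne'
  have := lt_of_le_of_ne (Real.cos_le_one (ω * t)) hne
  rw [circleCurve_re]
  exact mul_pos (by linarith) (by linarith)

theorem circleCurve_zero (d ω : ℝ) : circleCurve d ω 0 = 0 := by
  simp [circleCurve]

theorem circleCurve_two_pi_one (d : ℝ) : circleCurve d (2 * Real.pi) 1 = 0 := by
  simp [circleCurve, Complex.exp_two_pi_mul_I]

theorem circleCurve_one_of_exp_eq {d ω : ℝ} (hω : Complex.exp (ω * Complex.I) = -1) :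
    circleCurve d ω 1 = d := by
  simp only [circleCurve, Set.Icc.coe_one, mul_one, hω]
  push_cast; ring

theorem hasLogChange_circleCurve_inside {d x : ℝ} (ω : ℝ) (hx : 0 < x) (hxd : x < d) :
    HasLogChange (circleCurve d ω) x
      (ω * Complex.I + Complex.log ((d / 2 : ℝ) - (d / 2 - x : ℝ) * Complex.exp (-(ω * Complex.I)))
        - Complex.log x) := by
  have hre : ∀ θ : ℝ,
      0 < ((d / 2 : ℝ) - (d / 2 - x : ℝ) * Complex.exp (-(θ * Complex.I))).re := by
    intro θ
    have : -((θ : ℂ) * Complex.I) = ((-θ : ℝ) : ℂ) * Complex.I := by push_cast; ring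
    rw [this, Complex.sub_re, Complex.re_ofReal_mul, Complex.exp_ofReal_mul_I_re,
      Complex.ofReal_re]
    have h1 := Real.cos_le_one (-θ)
    have h2 := Real.neg_one_le_cos (-θ)
    have h3 : 0 ≤ (d - x) * (1 - Real.cos (-θ)) := mul_nonneg (by linarith) (by linarith)
    have h4 : 0 ≤ x * (1 + Real.cos (-θ)) := mul_nonneg hx.le (by linarith)
    rcases le_total (Real.cos (-θ)) 0 with h | h
    · nlinarith
    · nlinarith
  have hslit : ∀ t : I, ((d / 2 : ℝ) : ℂ) - (d / 2 - x : ℝ) *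
      Complex.exp (-((ω * t : ℝ) * Complex.I)) ∈ Complex.slitPlane := fun t => .inl (hre _)
  refine ⟨fun t => Real.pi * Complex.I + (ω * t : ℝ) * Complex.I +
    Complex.log ((d / 2 : ℝ) - (d / 2 - x : ℝ) * Complex.exp (-((ω * t : ℝ) * Complex.I))),
    ?_, fun t => ?_, ?_⟩
  · exact Continuous.add (by fun_prop) (Continuous.clog (by fun_prop) hslit)
  · rw [Complex.exp_add, Complex.exp_add, Complex.exp_pi_mul_I,
      Complex.exp_log (Complex.slitPlane_ne_zero (hslit t)), Complex.exp_neg, circleCurve]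
    field_simp [Complex.exp_ne_zero]
    push_cast
    ring
  · simp only [Set.Icc.coe_one, Set.Icc.coe_zero, mul_one, mul_zero, Complex.ofReal_zero, zero_mul,
      neg_zero, Complex.exp_zero]
    have : ((d / 2 : ℝ) : ℂ) - (d / 2 - x : ℝ) = x := by push_cast; ring
    rw [this]; ring

theorem hasLogChange_circleCurve_two_pi_inside {d x : ℝ} (hx : 0 < x) (hxd : x < d) :
    HasLogChange (circleCurve d (2 * Real.pi)) x (2 * Real.pi * Complex.I) := by
  convert hasLogChange_circleCurve_inside (2 * Real.pi) hx hxd using 1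
  have h : Complex.exp (-(((2 * Real.pi : ℝ) : ℂ) * Complex.I)) = 1 := by
    rw [Complex.exp_neg]; push_cast; rw [Complex.exp_two_pi_mul_I, inv_one]
  have : ((d / 2 : ℝ) : ℂ) - (d / 2 - x : ℝ) = x := by push_cast; ring
  rw [h, mul_one, this]
  push_cast; ring

theorem hasLogChange_circleCurve_two_pi_outside {d x : ℝ} (hd : 0 < d) (hxd : d < x) :
    HasLogChange (circleCurve d (2 * Real.pi)) x 0 := by
  have hslit : ∀ t : I, (x : ℂ) - circleCurve d (2 * Real.pi) t ∈ Complex.slitPlane := by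
    intro t
    refine .inl ?_
    rw [Complex.sub_re, circleCurve_re, Complex.ofReal_re]
    nlinarith [Real.neg_one_le_cos (2 * Real.pi * t)]
  refine ⟨fun t => Real.pi * Complex.I + Complex.log (x - circleCurve d (2 * Real.pi) t),
    ?_, fun t => ?_, ?_⟩
  · have := continuous_circleCurve d (2 * Real.pi)
    exact Continuous.add (by fun_prop) (Continuous.clog (by fun_prop) hslit)
  · rw [Complex.exp_add, Complex.exp_pi_mul_I,
      Complex.exp_log (Complex.slitPlane_ne_zero (hslit t))]
    ring
  · simp only [circleCurve_two_pi_one, circleCurve_zero, sub_self]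

/-- The radial part of the doubly winding loop. -/
noncomputable def plateau (t : I) : ℝ := min 1 (min (3 * (t : ℝ)) (3 - 3 * t))

/-- The angular part of the doubly winding loop. -/
noncomputable def ramp (t : I) : ℝ := 4 * Real.pi * max 0 (min 1 (3 * (t : ℝ) - 1))

/-- A loop at `0` that moves away from `1` along the negative real axis, winds twice around `1` on a
circle of radius `exp L` and comes back along the negative real axis. -/
noncomputable def doubleLoop (L : ℝ) (t : I) : ℂ :=
  1 - Complex.exp ((L * plateau t : ℝ) + (ramp t : ℝ) * Complex.I)

theorem continuous_plateau : Continuous plateau := by unfold plateau; fun_prop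

theorem continuous_ramp : Continuous ramp := by unfold ramp; fun_prop

theorem continuous_doubleLoop (L : ℝ) : Continuous (doubleLoop L) := by
  have := continuous_plateau
  have := continuous_ramp
  unfold doubleLoop; fun_prop

theorem plateau_zero : plateau 0 = 0 := by norm_num [plateau]

theorem plateau_one : plateau 1 = 0 := by norm_num [plateau]

theorem ramp_zero : ramp 0 = 0 := by norm_num [ramp]

theorem ramp_one : ramp 1 = 4 * Real.pi := by norm_num [ramp]

theorem exp_four_pi_mul_I : Complex.exp ((4 * Real.pi : ℝ) * Complex.I) = 1 := by
  rw [Complex.exp_eq_one_iff]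
  exact ⟨2, by push_cast; ring⟩

theorem doubleLoop_zero (L : ℝ) : doubleLoop L 0 = 0 := by
  simp [doubleLoop, plateau_zero, ramp_zero]

theorem doubleLoop_one (L : ℝ) : doubleLoop L 1 = 0 := by
  rw [doubleLoop, plateau_one, ramp_one, mul_zero, Complex.ofReal_zero, zero_add,
    exp_four_pi_mul_I, sub_self]

theorem hasLogChange_doubleLoop (L : ℝ) :
    HasLogChange (doubleLoop L) 1 (4 * Real.pi * Complex.I) := by
  have := continuous_plateau
  have := continuous_ramp
  refine ⟨fun t => Real.pi * Complex.I + ((L * plateau t : ℝ) + (ramp t : ℝ) * Complex.I),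
    by fun_prop, fun t => ?_, ?_⟩
  · rw [Complex.exp_add, Complex.exp_pi_mul_I, doubleLoop]
    ring
  · simp only [plateau_zero, plateau_one, ramp_zero, ramp_one]
    push_cast; ring

theorem doubleLoop_neg_or_large {L : ℝ} (hL : 0 < L) {t : I} (h0 : t ≠ 0) (h1 : t ≠ 1) :
    (doubleLoop L t).re < 0 ∨ L < ‖doubleLoop L t‖ := by
  have ht0 : (0 : ℝ) < t := unitInterval.pos_iff_ne_zero.2 h0
  have ht1 : (t : ℝ) < 1 := unitInterval.lt_one_iff_ne_one.2 h1
  by_cases hmid : plateau t = 1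
  · right
    have h := norm_sub_norm_le (Complex.exp ((L * plateau t : ℝ) + (ramp t : ℝ) * Complex.I)) 1
    rw [norm_sub_rev, Complex.norm_exp] at h
    simp only [hmid, mul_one, norm_one, Complex.add_re, Complex.ofReal_re, Complex.re_ofReal_mul,
      Complex.I_re, mul_zero, add_zero] at h
    rw [doubleLoop, hmid, mul_one]
    linarith [Real.add_one_lt_exp hL.ne']
  · left
    have hpos : 0 < plateau t := by
      simp only [plateau, lt_min_iff]
      exact ⟨one_pos, by linarith, by linarith⟩
    have hramp : Complex.exp ((ramp t : ℝ) * Complex.I) = 1 := by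
      rcases lt_or_ge (3 * (t : ℝ)) 1 with h | h
      · have : ramp t = 0 := by
          rw [ramp, min_eq_right (by linarith), max_eq_left (by linarith), mul_zero]
        simp [this]
      · have h2 : 3 - 3 * (t : ℝ) < 1 := by
          by_contra! h2
          exact hmid (min_eq_left (le_min h h2))
        have : ramp t = 4 * Real.pi := by
          rw [ramp, min_eq_left (by linarith), max_eq_right zero_le_one, mul_one]
        rw [this, exp_four_pi_mul_I]
    rw [doubleLoop, Complex.exp_add, hramp, mul_one, Complex.sub_re, Complex.exp_ofReal_re,
      Complex.one_re]
    linarith [Real.add_one_lt_exp (mul_pos hL hpos).ne', mul_pos hL hpos]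

/-- The kinds of edges used: a circular loop at `0` enclosing `1, …, k`, a half circle from `0` to
`k` (on either side of the real axis), and a loop at `0` winding twice around everything. -/
inductive EdgeShape
  | loop (k : ℕ)
  | arc (k : ℕ) (below : Bool)
  | double

namespace EdgeShape

/-- The curve of a given shape in the drawing with `n` vertices. -/
noncomputable def curve (n : ℕ) : EdgeShape → I → ℂ
  | loop k => circleCurve (k + 1 / 2) (2 * Real.pi)
  | arc k below => circleCurve k (if below then Real.pi else -Real.pi)
  | double => doubleLoop n

/-- The final vertex of the curve of a given shape. -/
def target : EdgeShape → ℕ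
  | loop _ => 0
  | arc k _ => k
  | double => 0

/-- The shapes used in the drawing with `n` vertices. -/
def Valid (n : ℕ) : EdgeShape → Prop
  | loop k => 1 ≤ k ∧ k < n
  | arc k below => 1 ≤ k ∧ k < n ∧ (below = false → 2 ≤ k)
  | double => 2 ≤ n

/-- The shape of the `i`-th edge. -/
def ofIndex (i : ℕ) : EdgeShape :=
  if i % 3 = 0 then loop (i / 3 + 1)
  else if i % 3 = 1 then arc (i / 3 + 1) true
  else if i / 3 = 0 then double
  else arc (i / 3 + 1) false

theorem ofIndex_injective : Function.Injective ofIndex := by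
  intro i j h
  unfold ofIndex at h
  split_ifs at h <;> simp only [loop.injEq, arc.injEq, reduceCtorEq] at h <;> grind

theorem valid_ofIndex {n i : ℕ} (h : i < 3 * n - 3) : (ofIndex i).Valid n := by
  unfold ofIndex
  split_ifs <;> simp only [Valid] <;> grind

theorem continuous_curve (n : ℕ) (s : EdgeShape) : Continuous (s.curve n) := by
  cases s
  · exact continuous_circleCurve _ _
  · exact continuous_circleCurve _ _
  · exact continuous_doubleLoop _

theorem curve_zero (n : ℕ) (s : EdgeShape) : s.curve n 0 = 0 := by
  cases s
  · exact circleCurve_zero _ _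
  · exact circleCurve_zero _ _
  · exact doubleLoop_zero _

theorem curve_one (n : ℕ) (s : EdgeShape) : s.curve n 1 = s.target := by
  rcases s with k | ⟨k, below⟩ | _
  · simpa [curve, target] using circleCurve_two_pi_one _
  · refine (circleCurve_one_of_exp_eq ?_).trans (by simp [target])
    cases below <;> simp [Complex.exp_neg, Complex.exp_pi_mul_I]
  · simpa [curve, target] using doubleLoop_one _

/-- The diameter of the circle carrying the curve. -/
noncomputable def diam : EdgeShape → ℝ
  | loop k => k + 1 / 2
  | arc k _ => k
  | double => 0

theorem curve_interior_of_ne_double {n : ℕ} {s : EdgeShape} (hs : s.Valid n) (hd : s ≠ double)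
    {t : I} (h0 : t ≠ 0) (h1 : t ≠ 1) :
    0 < (s.curve n t).re ∧ (s.curve n t).re ^ 2 + (s.curve n t).im ^ 2 =
      s.diam * (s.curve n t).re ∧ s.diam < n := by
  have hpi := Real.pi_pos
  rcases s with k | ⟨k, below⟩ | _
  · refine ⟨circleCurve_re_pos (by positivity) (by positivity) ?_ h0 h1, circleCurve_sq _ _ _, ?_⟩
    · rw [abs_of_pos (by positivity)]
    · have : (k : ℝ) + 1 ≤ n := by exact_mod_cast hs.2
      simp only [diam]; linarith
  · have : (0 : ℝ) < k := by exact_mod_cast hs.1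
    refine ⟨circleCurve_re_pos this ?_ ?_ h0 h1, circleCurve_sq _ _ _, ?_⟩
    · cases below <;> simp [Real.pi_ne_zero]
    · cases below <;> simp [abs_of_pos hpi] <;> linarith
    · simpa [diam] using hs.2.1
  · exact absurd rfl hd

theorem norm_curve_le {n : ℕ} {s : EdgeShape} (hs : s.Valid n) (hd : s ≠ double)
    {t : I} (h0 : t ≠ 0) (h1 : t ≠ 1) : ‖s.curve n t‖ ≤ n := by
  obtain ⟨hre, hsq, hn⟩ := curve_interior_of_ne_double hs hd h0 h1
  have h2 := Complex.re_le_norm (s.curve n t)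
  have h3 : ‖s.curve n t‖ ^ 2 = s.diam * (s.curve n t).re := by
    rw [Complex.sq_norm, Complex.normSq_apply, ← hsq]; ring
  nlinarith

theorem arc_im {n k : ℕ} (hk : 1 ≤ k) {t : I} (h0 : t ≠ 0) (h1 : t ≠ 1) :
    ((arc k true).curve n t).im < 0 ∧ 0 < ((arc k false).curve n t).im := by
  have ht0 : (0 : ℝ) < t := unitInterval.pos_iff_ne_zero.2 h0
  have ht1 : (t : ℝ) < 1 := unitInterval.lt_one_iff_ne_one.2 h1
  have hk' : (0 : ℝ) < k := by exact_mod_cast hk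
  have hsin : 0 < Real.sin (Real.pi * t) :=
    Real.sin_pos_of_pos_of_lt_pi (by positivity) (by nlinarith [Real.pi_pos])
  have : 0 < (k : ℝ) / 2 * Real.sin (Real.pi * t) := by positivity
  simp only [curve, circleCurve_im, if_true, Bool.false_eq_true, if_false, neg_mul, Real.sin_neg,
    mul_neg, neg_neg]
  exact ⟨by linarith, this⟩

theorem arc_im_ne_zero {n k : ℕ} (hk : 1 ≤ k) (below : Bool) {t : I} (h0 : t ≠ 0) (h1 : t ≠ 1) :
    ((arc k below).curve n t).im ≠ 0 := by
  cases below
  · exact (arc_im hk h0 h1).2.ne'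
  · exact (arc_im hk h0 h1).1.ne

theorem curve_ne_natCast {n j : ℕ} (hj : j < n) {s : EdgeShape} (hs : s.Valid n) {t : I}
    (h0 : t ≠ 0) (h1 : t ≠ 1) : s.curve n t ≠ j := by
  intro h
  rcases s with k | ⟨k, below⟩ | _
  · obtain ⟨hre, hsq, -⟩ := curve_interior_of_ne_double hs (by simp) h0 h1
    rw [h] at hre hsq
    simp only [Complex.natCast_re, Complex.natCast_im, diam] at hre hsq
    have : (j : ℝ) = k + 1 / 2 := mul_right_cancel₀ hre.ne' (by linarith)
    have : ((2 * j : ℕ) : ℝ) = (2 * k + 1 : ℕ) := by push_cast; linarith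
    have := Nat.cast_injective this
    omega
  · exact arc_im_ne_zero hs.1 below h0 h1 (by rw [h, Complex.natCast_im])
  · have hn : (0 : ℝ) < n := by exact_mod_cast hj.pos
    have hj' : (j : ℝ) < n := by exact_mod_cast hj
    have := doubleLoop_neg_or_large hn h0 h1
    change doubleLoop n t = j at h
    rw [h, Complex.natCast_re, Complex.norm_natCast] at this
    rcases this with h | h
    · exact absurd h (not_lt.2 j.cast_nonneg)
    · linarith

theorem curve_ne_doubleLoop {n : ℕ} {s : EdgeShape} (hs : s.Valid n) (hd : s ≠ double)
    {t t' : I} (h0 : t ≠ 0) (h1 : t ≠ 1) (h0' : t' ≠ 0) (h1' : t' ≠ 1) :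
    s.curve n t ≠ doubleLoop n t' := by
  intro h
  obtain ⟨hre, -, -⟩ := curve_interior_of_ne_double hs hd h0 h1
  have hnorm := norm_curve_le hs hd h0 h1
  have hn : (0 : ℝ) < n := by
    have : 0 < n := by cases s <;> simp only [Valid] at hs <;> omega
    exact_mod_cast this
  have := doubleLoop_neg_or_large hn h0' h1'
  rw [← h] at this
  rcases this with h | h <;> linarith

theorem curve_ne_curve {n : ℕ} {s s' : EdgeShape} (hs : s.Valid n) (hs' : s'.Valid n) (hne : s ≠ s')
    {t t' : I} (h0 : t ≠ 0) (h1 : t ≠ 1) (h0' : t' ≠ 0) (h1' : t' ≠ 1) :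
    s.curve n t ≠ s'.curve n t' := by
  by_cases hd : s = double
  · subst hd
    exact (curve_ne_doubleLoop hs' hne.symm h0' h1' h0 h1).symm
  by_cases hd' : s' = double
  · subst hd'
    exact curve_ne_doubleLoop hs hne h0 h1 h0' h1'
  intro h
  obtain ⟨hre, hsq, -⟩ := curve_interior_of_ne_double hs hd h0 h1
  obtain ⟨-, hsq', -⟩ := curve_interior_of_ne_double hs' hd' h0' h1'
  rw [← h, hsq] at hsq'
  have hdiam := mul_right_cancel₀ hre.ne' hsq'
  rcases s with k | ⟨k, b⟩ | _ <;> rcases s' with k' | ⟨k', b'⟩ | _ <;> try contradiction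
  · exact hne (by simpa [diam] using hdiam)
  · simp only [diam] at hdiam
    have : ((2 * k + 1 : ℕ) : ℝ) = (2 * k' : ℕ) := by push_cast; linarith
    have := Nat.cast_injective this
    omega
  · simp only [diam] at hdiam
    have : ((2 * k : ℕ) : ℝ) = (2 * k' + 1 : ℕ) := by push_cast; linarith
    have := Nat.cast_injective this
    omega
  · obtain rfl : k = k' := by simpa [diam] using hdiam
    have him := congrArg Complex.im h
    have hi := arc_im (n := n) hs.1 h0 h1
    have hi' := arc_im (n := n) hs.1 h0' h1'
    cases b <;> cases b' <;> first | exact hne rfl | linarith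

theorem hasLogChange_loop (n : ℕ) {k j : ℕ} (hj : 1 ≤ j) :
    HasLogChange ((loop k).curve n) j (if j ≤ k then 2 * Real.pi * Complex.I else 0) := by
  have hj' : (0 : ℝ) < j := by exact_mod_cast hj
  rw [← Complex.ofReal_natCast]
  split_ifs with h
  · have : (j : ℝ) ≤ k := by exact_mod_cast h
    exact hasLogChange_circleCurve_two_pi_inside hj' (by linarith)
  · have : (k : ℝ) + 1 ≤ j := by exact_mod_cast not_le.1 h
    exact hasLogChange_circleCurve_two_pi_outside (by positivity) (by linarith)

theorem not_homotopicIn_arc {V : Set ℂ} (hV : 1 ∈ V) {n k : ℕ} (hk : 2 ≤ k) (b : Bool) :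
    ¬ HomotopicIn V ((arc k b).curve n) ((arc k !b).curve n) := by
  intro h
  have hk' : (1 : ℝ) < k := by exact_mod_cast hk
  have key : ∀ ω : ℝ, HasLogChange (circleCurve k ω) 1 _ := fun ω => by
    simpa only [Complex.ofReal_one] using hasLogChange_circleCurve_inside ω one_pos hk'
  have heq := h.logChange_eq hV (key _) (key _)
  have hexp : Complex.exp (-(Real.pi * Complex.I)) = -1 := by
    rw [Complex.exp_neg, Complex.exp_pi_mul_I]; norm_num
  have := congrArg Complex.im heq
  cases b <;> simp [hexp, Complex.exp_pi_mul_I] at this <;> linarith [Real.pi_pos]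

theorem not_edgeHomotopic {V : Set ℂ} {n : ℕ} (hV : ∀ j < n, (j : ℂ) ∈ V) {s s' : EdgeShape}
    (hs : s.Valid n) (hs' : s'.Valid n) (hne : s ≠ s') :
    ¬ EdgeHomotopic V (s.curve n) (s'.curve n) := by
  intro h
  have htarget : s.target = s'.target := by
    have := h.endpoints
    simp only [curve_zero, curve_one] at this
    norm_cast at this
    omega
  have hpi : (Real.pi : ℂ) ≠ 0 := Complex.ofReal_ne_zero.2 Real.pi_ne_zero
  have h24 : ∀ z : ℂ, z ≠ 0 → ¬ (2 * z = 4 * z ∨ -(2 * z) = 4 * z) := by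
    rintro z hz (h | h)
    · exact hz (by linear_combination -h / 2)
    · exact hz (by linear_combination -h / 6)
  have hpiI : (Real.pi : ℂ) * Complex.I ≠ 0 := mul_ne_zero hpi Complex.I_ne_zero
  rcases s with k | ⟨k, b⟩ | _ <;> rcases s' with k' | ⟨k', b'⟩ | _ <;>
    simp only [target, Valid] at htarget hs hs'
  · have key : ∀ j, 1 ≤ j → j < n → (j ≤ k ↔ j ≤ k') := by
      intro j hj hjn
      have := h.logChange_eq_or (hV j hjn) (hasLogChange_loop n hj) (hasLogChange_loop n hj)
      split_ifs at this <;> simp_all [not_le.2]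
    have := key k hs.1 hs.2
    have := key k' hs'.1 hs'.2
    exact hne (by simp only [loop.injEq]; omega)
  · omega
  · have := h.logChange_eq_or (by simpa using hV 1 (by omega))
      (by simpa [hs.1] using hasLogChange_loop n (k := k) le_rfl) (hasLogChange_doubleLoop n)
    simp only [mul_assoc] at this
    exact h24 _ hpiI this
  · omega
  · subst htarget
    have hb : b' = !b := by cases b <;> cases b' <;> simp_all
    subst hb
    have hk : 2 ≤ k := by cases b <;> simp_all
    rcases h with h' | h'
    · exact not_homotopicIn_arc (by simpa using hV 1 (by omega)) hk b h'
    · have := h'.endpoints.1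
      simp only [unitInterval.symm_zero, curve_one, curve_zero, target] at this
      norm_cast at this
      omega
  · omega
  · have := h.logChange_eq_or (by simpa using hV 1 (by omega)) (hasLogChange_doubleLoop n)
      (by simpa [hs'.1] using hasLogChange_loop n (k := k') le_rfl)
    simp only [mul_assoc] at this
    exact h24 _ hpiI (this.imp Eq.symm fun h => by rw [← h, neg_neg])
  · omega
  · exact hne rfl

theorem not_isTrivialLoop {V : Set ℂ} {n : ℕ} (hV : ∀ j < n, (j : ℂ) ∈ V) {s : EdgeShape}
    (hs : s.Valid n) : ¬ IsTrivialLoop V (s.curve n) := by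
  intro h
  unfold IsTrivialLoop at h
  rw [curve_zero] at h
  have hconst : HasLogChange (fun _ => 0) 1 0 := hasLogChange_const zero_ne_one
  have hpi : (Real.pi : ℂ) ≠ 0 := Complex.ofReal_ne_zero.2 Real.pi_ne_zero
  rcases s with k | ⟨k, b⟩ | _ <;> simp only [Valid] at hs
  · have := h.logChange_eq_or (by simpa using hV 1 (by omega))
      (by simpa [hs.1] using hasLogChange_loop n (k := k) le_rfl) hconst
    simp [hpi] at this
  · have := h.endpoints
    simp only [curve_zero, curve_one, target] at this
    norm_cast at this
    omega
  · have := h.logChange_eq_or (by simpa using hV 1 (by omega)) (hasLogChange_doubleLoop n) hconst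
    simp [hpi] at this

theorem target_lt {n : ℕ} {s : EdgeShape} (hs : s.Valid n) : s.target < n := by
  cases s <;> simp only [Valid, target] at * <;> omega

end EdgeShape

/-- The drawing with vertices `0, …, n - 1` whose edges are given by the valid shapes. -/
noncomputable def tightDrawing (n : ℕ) (hn : 1 ≤ n) : PlaneDrawing n (3 * n - 3) where
  V := (fun j : ℕ => (j : ℂ)) '' Set.Iio n
  finV := (Set.finite_Iio n).image _
  cardV := by
    rw [Set.ncard_image_of_injective _ Nat.cast_injective, Set.ncard_eq_toFinset_card']
    simp
  f e := (EdgeShape.ofIndex e).curve n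
  cont e := EdgeShape.continuous_curve _ _
  source_mem e := ⟨0, hn, by simp [EdgeShape.curve_zero]⟩
  target_mem e := ⟨_, EdgeShape.target_lt (EdgeShape.valid_ofIndex e.2),
    (EdgeShape.curve_one _ _).symm⟩
  interior_not_mem e t h0 h1 := by
    rintro ⟨j, hj, h⟩
    exact EdgeShape.curve_ne_natCast hj (EdgeShape.valid_ofIndex e.2) h0 h1 h.symm

/-- For every `n ≥ 1` there is a loose non-homotopic drawing in the
plane with `n` vertices and exactly `3n - 3` edges. -/
theorem loose_plane_edge_bound_tight (n : ℕ) (hn : 1 ≤ n) :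
    ∃ D : PlaneDrawing n (3 * n - 3), D.Loose ∧ D.NonHomotopic := by
  have hne : ∀ e e' : Fin (3 * n - 3), e ≠ e' →
      EdgeShape.ofIndex e ≠ EdgeShape.ofIndex e' := fun e e' h h' =>
    h (Fin.ext (EdgeShape.ofIndex_injective h'))
  have hV : ∀ j < n, (j : ℂ) ∈ (tightDrawing n hn).V := fun j hj => ⟨j, hj, rfl⟩
  refine ⟨tightDrawing n hn, fun e e' h t t' h0 h1 h0' h1' => ?_, fun e e' h => ?_, fun e => ?_⟩
  · exact EdgeShape.curve_ne_curve (EdgeShape.valid_ofIndex e.2) (EdgeShape.valid_ofIndex e'.2)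
      (hne e e' h) h0 h1 h0' h1'
  · exact EdgeShape.not_edgeHomotopic hV (EdgeShape.valid_ofIndex e.2)
      (EdgeShape.valid_ofIndex e'.2) (hne e e' h)
  · exact EdgeShape.not_isTrivialLoop hV (EdgeShape.valid_ofIndex e.2)
end
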